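/- arXiv:1401.1722 — 5 statements merged into one kernel-verified Lean document; each statement's English description precedes it below -/
import Mathlib

section
/- Let C and D be abelian categories such that C has enough projectives and D has enough injectives. Let F, G : C ⥤ D be functors admitting right adjoints F^∨, G^∨ : D ⥤ C, let α : F ⟶ G be a natural transformation with mate α^∨ : G^∨ ⟶ F^∨, and set K := ker(α) in the functor category C ⥤ D and Q := coker(α^∨) in D ⥤ C. Then the zeroth left derived functor L₀K : C ⥤ D is left adjoint to the zeroth right derived functor R⁰Q : D ⥤ C. -/
open CategoryTheory CategoryTheory.Limits
section
variable {C : Type*} [Category C] {D : Type*} [Category D] [Abelian C] [Abelian D]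

lemma cancel_gen {A B B' B'' Z : D} (a : A ⟶ B) (i : B' ≅ B) (j : B'' ≅ B') (b : B ⟶ Z) :
    (a ≫ i.inv ≫ j.inv) ≫ (j.hom ≫ i.hom ≫ b) = a ≫ b := by simp

lemma epi_gen {A B B' B'' : D} (a : A ⟶ B) (i : B' ≅ B) (j : B'' ≅ B') [Epi a] :
    Epi (a ≫ i.inv ≫ j.inv) := inferInstance

lemma cancel_gen' {A B B' B'' Z : D} (a : Z ⟶ B) (i : B ≅ B') (j : B'' ≅ B') (b : B ⟶ A) :
    (a ≫ i.hom ≫ j.inv) ≫ (j.hom ≫ i.inv ≫ b) = a ≫ b := by simp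

lemma mono_gen {A B B' B'' : D} (i : B ≅ B') (j : B'' ≅ B') (b : B ⟶ A) [Mono b] :
    Mono (j.hom ≫ i.inv ≫ b) := inferInstance

/-- The canonical map `K P₀ ⟶ L₀K X`. -/
noncomputable def lBeta [EnoughProjectives C] (K : C ⥤ D) [K.Additive] {X : C}
    (P : ProjectiveResolution X) : K.obj (P.complex.X 0) ⟶ (K.leftDerived 0).obj X :=
  HomologicalComplex.pOpcycles ((K.mapHomologicalComplex (ComplexShape.down ℕ)).obj P.complex) 0 ≫
    (ChainComplex.isoHomologyι₀
      ((K.mapHomologicalComplex (ComplexShape.down ℕ)).obj P.complex)).inv ≫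
    (P.isoLeftDerivedObj K 0).inv

lemma lBeta_nat [EnoughProjectives C] (K : C ⥤ D) [K.Additive] {X Y : C}
    (P : ProjectiveResolution X) (Q : ProjectiveResolution Y) (f : X ⟶ Y)
    (φ : P.complex ⟶ Q.complex) (comm : φ.f 0 ≫ Q.π.f 0 = P.π.f 0 ≫ f) :
    lBeta K P ≫ (K.leftDerived 0).map f = K.map (φ.f 0) ≫ lBeta K Q := by
  have h1 := ProjectiveResolution.isoLeftDerivedObj_inv_naturality f P Q φ comm K 0
  have h2 := ChainComplex.isoHomologyι₀_inv_naturality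
    (φ := (K.mapHomologicalComplex (ComplexShape.down ℕ)).map φ)
  have h3 := HomologicalComplex.p_opcyclesMap
    ((K.mapHomologicalComplex (ComplexShape.down ℕ)).map φ) 0
  unfold lBeta
  refine (Category.assoc _ _ _).trans ?_
  refine (congrArg (_ ≫ ·) (Category.assoc _ _ _)).trans ?_
  refine (congrArg (fun t => _ ≫ _ ≫ t) h1).trans ?_
  refine (congrArg (_ ≫ ·) (Category.assoc _ _ _).symm).trans ?_
  refine (congrArg (fun t => _ ≫ t ≫ _) h2).trans ?_
  refine (congrArg (_ ≫ ·) (Category.assoc _ _ _)).trans ?_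
  refine (Category.assoc _ _ _).symm.trans ?_
  refine (congrArg (· ≫ _) h3).trans ?_
  exact Category.assoc _ _ _

lemma lBeta_eps [EnoughProjectives C] (K : C ⥤ D) [K.Additive] {X : C}
    (P : ProjectiveResolution X) (p : P.complex.X 0 ⟶ X) (hp : P.π.f 0 = p) :
    lBeta K P ≫ K.fromLeftDerivedZero.app X = K.map p := by
  subst hp
  have h := P.pOpcycles_comp_fromLeftDerivedZero' K
  rw [P.fromLeftDerivedZero_eq]
  unfold lBeta
  refine Eq.trans ?_ h
  exact cancel_gen _ _ _ _

lemma lBeta_epi [EnoughProjectives C] (K : C ⥤ D) [K.Additive] {X : C}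
    (P : ProjectiveResolution X) : Epi (lBeta K P) := by
  unfold lBeta
  exact epi_gen (HomologicalComplex.pOpcycles
    ((K.mapHomologicalComplex (ComplexShape.down ℕ)).obj P.complex) 0) _ _

lemma lBeta_d [EnoughProjectives C] (K : C ⥤ D) [K.Additive] {X : C}
    (P : ProjectiveResolution X) : K.map (P.complex.d 1 0) ≫ lBeta K P = 0 := by
  unfold lBeta
  have h := HomologicalComplex.d_pOpcycles
    ((K.mapHomologicalComplex (ComplexShape.down ℕ)).obj P.complex) 1 0
  refine (Category.assoc _ _ _).symm.trans ?_
  refine (congrArg (· ≫ _) h).trans ?_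
  exact zero_comp

lemma lBeta_desc [EnoughProjectives C] (K : C ⥤ D) [K.Additive] {X : C}
    (P : ProjectiveResolution X) (T : D) (g : K.obj (P.complex.X 0) ⟶ T)
    (hg : K.map (P.complex.d 1 0) ≫ g = 0) : ∃ g', lBeta K P ≫ g' = g := by
  let KP := (K.mapHomologicalComplex (ComplexShape.down ℕ)).obj P.complex
  refine ⟨(P.isoLeftDerivedObj K 0).hom ≫ (ChainComplex.isoHomologyι₀ KP).hom ≫
    KP.descOpcycles g 1 (by simp) hg, ?_⟩
  refine Eq.trans ?_ (KP.p_descOpcycles g 1 (by simp) hg)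
  unfold lBeta
  exact cancel_gen _ _ _ _

lemma lMap_eq [EnoughProjectives C] (K : C ⥤ D) [K.Additive] {X : C}
    (P : ProjectiveResolution X) (p : P.complex.X 0 ⟶ X) (hp : P.π.f 0 = p) :
    (K.leftDerived 0).map p = K.fromLeftDerivedZero.app (P.complex.X 0) ≫ lBeta K P := by
  have := P.projective 0
  let E := ProjectiveResolution.self (P.complex.X 0)
  let φ : E.complex ⟶ P.complex :=
    (ChainComplex.fromSingle₀Equiv P.complex (P.complex.X 0)).symm (𝟙 _)
  have hφ : φ.f 0 = 𝟙 (P.complex.X 0) :=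
    ChainComplex.fromSingle₀Equiv_symm_apply_f_zero (C := P.complex) (𝟙 _)
  let β : K.obj (P.complex.X 0) ⟶ (K.leftDerived 0).obj (P.complex.X 0) := lBeta K E
  have h1 : β ≫ K.fromLeftDerivedZero.app (P.complex.X 0) = K.map (𝟙 _) := lBeta_eps K E (𝟙 _) rfl
  have h2 : β ≫ (K.leftDerived 0).map p = K.map (𝟙 _) ≫ lBeta K P := by
    refine (lBeta_nat K E P p φ ?_).trans (congrArg (fun t => K.map t ≫ lBeta K P) hφ)
    rw [hφ, hp]
    rfl
  have i0 : IsIso (K.fromLeftDerivedZero.app (P.complex.X 0)) := inferInstance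
  have h3 : K.fromLeftDerivedZero.app (P.complex.X 0) ≫ β = 𝟙 _ := by
    rw [← cancel_mono (K.fromLeftDerivedZero.app (P.complex.X 0)), Category.assoc, h1]
    simp
  rw [CategoryTheory.Functor.map_id, Category.id_comp] at h2
  rw [← h2, reassoc_of% h3]

lemma ker_desc {F G : C ⥤ D} (α : F ⟶ G) (P : C) (I : D) [Injective I] (h : F.obj P ⟶ I)
    (w : (kernel.ι α).app P ≫ h = 0) : ∃ k, α.app P ≫ k = h := by
  let S := ShortComplex.mk (kernel.ι α) α (kernel.condition α)
  have hS : S.Exact := ShortComplex.exact_kernel α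
  have := hS.map ((evaluation C D).obj P)
  exact ⟨this.descToInjective h w, this.comp_descToInjective h w⟩

lemma coker_lift {F G : D ⥤ C} (α : F ⟶ G) (I : D) (P : C) [Projective P] (h : P ⟶ G.obj I)
    (w : h ≫ (cokernel.π α).app I = 0) : ∃ k, k ≫ α.app I = h := by
  let S := ShortComplex.mk α (cokernel.π α) (cokernel.condition α)
  have hS : S.Exact := ShortComplex.exact_cokernel α
  have := hS.map ((evaluation D C).obj I)
  exact ⟨this.liftFromProjective h w, this.liftFromProjective_comp h w⟩

lemma left_pres [EnoughProjectives C] (K : C ⥤ D) [K.Additive] (X : C) :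
   ∃ (P₁ P₀ : C) (d : P₁ ⟶ P₀) (p : P₀ ⟶ X), Projective P₁ ∧ Projective P₀ ∧
      d ≫ p = 0 ∧ Epi p ∧ (∀ (T : C) (g : P₀ ⟶ T), d ≫ g = 0 → ∃ g', p ≫ g' = g) ∧
      Epi ((K.leftDerived 0).map p) ∧ (K.leftDerived 0).map d ≫ (K.leftDerived 0).map p = 0 ∧
      (∀ (T : D) (g : (K.leftDerived 0).obj P₀ ⟶ T), (K.leftDerived 0).map d ≫ g = 0 →
        ∃ g', (K.leftDerived 0).map p ≫ g' = g) := by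
  obtain ⟨P⟩ : Nonempty (ProjectiveResolution X) := ⟨projectiveResolution X⟩
  have h0 : Projective (P.complex.X 0) := P.projective 0
  have h1 : Projective (P.complex.X 1) := P.projective 1
  obtain ⟨p, hp⟩ : ∃ p : P.complex.X 0 ⟶ X, P.π.f 0 = p := ⟨_, rfl⟩
  have hp' : Epi p := by subst hp; exact inferInstanceAs (Epi (P.π.f 0))
  have w : P.complex.d 1 0 ≫ p = 0 := by subst hp; exact P.complex_d_comp_π_f_zero
  have key := lMap_eq K P p hp
  have i0 : IsIso (K.fromLeftDerivedZero.app (P.complex.X 0)) := inferInstance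
  have i1 : IsIso (K.fromLeftDerivedZero.app (P.complex.X 1)) := inferInstance
  have := lBeta_epi K P
  refine ⟨_, _, P.complex.d 1 0, p, h1, h0, w, hp', ?_, ?_, ?_, ?_⟩
  · intro T g hg
    subst hp
    exact ⟨P.isColimitCokernelCofork.desc (CokernelCofork.ofπ g hg),
      P.isColimitCokernelCofork.fac (CokernelCofork.ofπ g hg) WalkingParallelPair.one⟩
  · rw [key]; exact epi_comp _ _
  · rw [key, NatTrans.naturality_assoc, lBeta_d, comp_zero]
  · intro T g hg
    obtain ⟨g', hg'⟩ := lBeta_desc K P T (inv (K.fromLeftDerivedZero.app (P.complex.X 0)) ≫ g) (by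
      rw [← cancel_epi (K.fromLeftDerivedZero.app (P.complex.X 1)),
        ← NatTrans.naturality_assoc, IsIso.hom_inv_id_assoc, hg, comp_zero])
    exact ⟨g', by rw [key, Category.assoc, hg', IsIso.hom_inv_id_assoc]⟩

/-- The canonical map `R⁰K Y ⟶ K I⁰`. -/
noncomputable def rBeta [EnoughInjectives C] (K : C ⥤ D) [K.Additive] {Y : C}
    (I : InjectiveResolution Y) : (K.rightDerived 0).obj Y ⟶ K.obj (I.cocomplex.X 0) :=
  (I.isoRightDerivedObj K 0).hom ≫
    (CochainComplex.isoHomologyπ₀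
      ((K.mapHomologicalComplex (ComplexShape.up ℕ)).obj I.cocomplex)).inv ≫
    HomologicalComplex.iCycles ((K.mapHomologicalComplex (ComplexShape.up ℕ)).obj I.cocomplex) 0

lemma rBeta_nat [EnoughInjectives C] (K : C ⥤ D) [K.Additive] {X Y : C}
    (I : InjectiveResolution X) (J : InjectiveResolution Y) (f : X ⟶ Y)
    (φ : I.cocomplex ⟶ J.cocomplex) (comm : I.ι.f 0 ≫ φ.f 0 = f ≫ J.ι.f 0) :
    (K.rightDerived 0).map f ≫ rBeta K J = rBeta K I ≫ K.map (φ.f 0) := by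
  have h1 := InjectiveResolution.isoRightDerivedObj_hom_naturality f I J φ comm K 0
  have h2 := CochainComplex.isoHomologyπ₀_inv_naturality
    (φ := (K.mapHomologicalComplex (ComplexShape.up ℕ)).map φ)
  have h3 := HomologicalComplex.cyclesMap_i
    ((K.mapHomologicalComplex (ComplexShape.up ℕ)).map φ) 0
  unfold rBeta
  refine (Category.assoc _ _ _).symm.trans ?_
  refine (congrArg (· ≫ _) h1).trans ?_
  refine (Category.assoc _ _ _).trans ?_
  refine (congrArg (_ ≫ ·) (Category.assoc _ _ _).symm).trans ?_
  refine (congrArg (fun t => _ ≫ t ≫ _) h2).trans ?_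
  refine (congrArg (_ ≫ ·) (Category.assoc _ _ _)).trans ?_
  refine (congrArg (fun t => _ ≫ _ ≫ t) h3).trans ?_
  refine (congrArg (_ ≫ ·) (Category.assoc _ _ _).symm).trans ?_
  exact (Category.assoc _ _ _).symm

lemma rBeta_eta [EnoughInjectives C] (K : C ⥤ D) [K.Additive] {Y : C}
    (I : InjectiveResolution Y) (i : Y ⟶ I.cocomplex.X 0) (hi : I.ι.f 0 = i) :
    K.toRightDerivedZero.app Y ≫ rBeta K I = K.map i := by
  subst hi
  have h := I.toRightDerivedZero'_comp_iCycles K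
  rw [I.toRightDerivedZero_eq]
  unfold rBeta
  refine Eq.trans ?_ h
  exact cancel_gen' _ _ _ _

lemma rBeta_mono [EnoughInjectives C] (K : C ⥤ D) [K.Additive] {Y : C}
    (I : InjectiveResolution Y) : Mono (rBeta K I) := by
  unfold rBeta
  exact mono_gen _ _ (HomologicalComplex.iCycles
    ((K.mapHomologicalComplex (ComplexShape.up ℕ)).obj I.cocomplex) 0)

lemma rBeta_d [EnoughInjectives C] (K : C ⥤ D) [K.Additive] {Y : C}
    (I : InjectiveResolution Y) : rBeta K I ≫ K.map (I.cocomplex.d 0 1) = 0 := by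
  unfold rBeta
  have h := HomologicalComplex.iCycles_d
    ((K.mapHomologicalComplex (ComplexShape.up ℕ)).obj I.cocomplex) 0 1
  refine (Category.assoc _ _ _).trans ?_
  refine (congrArg (_ ≫ ·) (Category.assoc _ _ _)).trans ?_
  refine (congrArg (fun t => _ ≫ _ ≫ t) h).trans ?_
  refine (congrArg (_ ≫ ·) comp_zero).trans ?_
  exact comp_zero

lemma rBeta_lift [EnoughInjectives C] (K : C ⥤ D) [K.Additive] {Y : C}
    (I : InjectiveResolution Y) (T : D) (g : T ⟶ K.obj (I.cocomplex.X 0))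
    (hg : g ≫ K.map (I.cocomplex.d 0 1) = 0) : ∃ g', g' ≫ rBeta K I = g := by
  let KI := (K.mapHomologicalComplex (ComplexShape.up ℕ)).obj I.cocomplex
  refine ⟨KI.liftCycles g 1 (by simp) hg ≫ (CochainComplex.isoHomologyπ₀ KI).hom ≫
    (I.isoRightDerivedObj K 0).inv, ?_⟩
  refine Eq.trans ?_ (KI.liftCycles_i g 1 (by simp) hg)
  unfold rBeta
  exact cancel_gen' _ _ _ _

lemma rMap_eq [EnoughInjectives C] (K : C ⥤ D) [K.Additive] {Y : C}
    (I : InjectiveResolution Y) (i : Y ⟶ I.cocomplex.X 0) (hi : I.ι.f 0 = i) :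
    (K.rightDerived 0).map i = rBeta K I ≫ K.toRightDerivedZero.app (I.cocomplex.X 0) := by
  have := I.injective 0
  let E := InjectiveResolution.self (I.cocomplex.X 0)
  let φ : I.cocomplex ⟶ E.cocomplex :=
    (CochainComplex.toSingle₀Equiv I.cocomplex (I.cocomplex.X 0)).symm (𝟙 _)
  have hφ : φ.f 0 = 𝟙 (I.cocomplex.X 0) :=
    CochainComplex.toSingle₀Equiv_symm_apply_f_zero (C := I.cocomplex) (𝟙 _)
  let β : (K.rightDerived 0).obj (I.cocomplex.X 0) ⟶ K.obj (I.cocomplex.X 0) := rBeta K E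
  have h1 : K.toRightDerivedZero.app (I.cocomplex.X 0) ≫ β = K.map (𝟙 _) :=
    rBeta_eta K E (𝟙 _) rfl
  have h2 : (K.rightDerived 0).map i ≫ β = rBeta K I ≫ K.map (𝟙 _) := by
    refine (rBeta_nat K I E i φ ?_).trans (congrArg (fun t => rBeta K I ≫ K.map t) hφ)
    rw [hφ, hi]
    rfl
  have i0 : IsIso (K.toRightDerivedZero.app (I.cocomplex.X 0)) := inferInstance
  have h3 : β ≫ K.toRightDerivedZero.app (I.cocomplex.X 0) = 𝟙 _ := by
    rw [← cancel_epi (K.toRightDerivedZero.app (I.cocomplex.X 0)), reassoc_of% h1]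
    simp
  rw [CategoryTheory.Functor.map_id, Category.comp_id] at h2
  rw [← h2, Category.assoc, h3, Category.comp_id]

lemma right_pres [EnoughInjectives C] (K : C ⥤ D) [K.Additive] (Y : C) :
    ∃ (I₀ I₁ : C) (d : I₀ ⟶ I₁) (i : Y ⟶ I₀), Injective I₀ ∧ Injective I₁ ∧
      i ≫ d = 0 ∧ Mono i ∧ (∀ (T : C) (g : T ⟶ I₀), g ≫ d = 0 → ∃ g', g' ≫ i = g) ∧
      Mono ((K.rightDerived 0).map i) ∧ (K.rightDerived 0).map i ≫ (K.rightDerived 0).map d = 0 ∧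
      (∀ (T : D) (g : T ⟶ (K.rightDerived 0).obj I₀), g ≫ (K.rightDerived 0).map d = 0 →
        ∃ g', g' ≫ (K.rightDerived 0).map i = g) := by
  obtain ⟨I⟩ : Nonempty (InjectiveResolution Y) := ⟨injectiveResolution Y⟩
  have h0 : Injective (I.cocomplex.X 0) := I.injective 0
  have h1 : Injective (I.cocomplex.X 1) := I.injective 1
  obtain ⟨i, hi⟩ : ∃ i : Y ⟶ I.cocomplex.X 0, I.ι.f 0 = i := ⟨_, rfl⟩
  have hi' : Mono i := by subst hi; exact inferInstanceAs (Mono (I.ι.f 0))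
  have w : i ≫ I.cocomplex.d 0 1 = 0 := by subst hi; exact I.ι_f_zero_comp_complex_d
  have key := rMap_eq K I i hi
  have i0 : IsIso (K.toRightDerivedZero.app (I.cocomplex.X 0)) := inferInstance
  have i1 : IsIso (K.toRightDerivedZero.app (I.cocomplex.X 1)) := inferInstance
  have := rBeta_mono K I
  refine ⟨_, _, I.cocomplex.d 0 1, i, h0, h1, w, hi', ?_, ?_, ?_, ?_⟩
  · intro T g hg
    subst hi
    exact ⟨I.isLimitKernelFork.lift (KernelFork.ofι g hg),
      I.isLimitKernelFork.fac (KernelFork.ofι g hg) WalkingParallelPair.zero⟩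
  · rw [key]; exact mono_comp _ _
  · rw [key, Category.assoc, ← NatTrans.naturality, ← Category.assoc, rBeta_d, zero_comp]
  · intro T g hg
    obtain ⟨g', hg'⟩ := rBeta_lift K I T (g ≫ inv (K.toRightDerivedZero.app (I.cocomplex.X 0))) (by
      rw [← cancel_mono (K.toRightDerivedZero.app (I.cocomplex.X 1)), Category.assoc,
        Category.assoc, NatTrans.naturality, IsIso.inv_hom_id_assoc, hg, zero_comp])
    exact ⟨g', by rw [key, ← Category.assoc, hg', Category.assoc, IsIso.inv_hom_id,
      Category.comp_id]⟩
end


theorem abstract_adj {C : Type*} [Category C] {D : Type*} [Category D] [Abelian C] [Abelian D]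
    (L : C ⥤ D) (R : D ⥤ C)
    (S : ∀ {P : C} {I : D}, (L.obj P ⟶ I) → (P ⟶ R.obj I) → Prop)
    (S_pre : ∀ {P' P : C} {I : D} (p : P' ⟶ P) (f : L.obj P ⟶ I) (g : P ⟶ R.obj I),
      S f g → S (L.map p ≫ f) (p ≫ g))
    (S_post : ∀ {P : C} {I I' : D} (i : I ⟶ I') (f : L.obj P ⟶ I) (g : P ⟶ R.obj I),
      S f g → S (f ≫ i) (g ≫ R.map i))
    (S_zero : ∀ (P : C) (I : D), S (0 : L.obj P ⟶ I) 0)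
    (S_ex : ∀ {P : C} {I : D} [Projective P] [Injective I] (f : L.obj P ⟶ I), ∃ g, S f g)
    (S_ex' : ∀ {P : C} {I : D} [Projective P] [Injective I] (g : P ⟶ R.obj I), ∃ f, S f g)
    (S_un : ∀ {P : C} {I : D} [Projective P] [Injective I] (f : L.obj P ⟶ I) (g g'),
      S f g → S f g' → g = g')
    (S_un' : ∀ {P : C} {I : D} [Projective P] [Injective I] (f f' : L.obj P ⟶ I) (g),
      S f g → S f' g → f = f')
    (hL : ∀ X : C, ∃ (P₁ P₀ : C) (d : P₁ ⟶ P₀) (p : P₀ ⟶ X), Projective P₁ ∧ Projective P₀ ∧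
      d ≫ p = 0 ∧ Epi p ∧ (∀ (T : C) (g : P₀ ⟶ T), d ≫ g = 0 → ∃ g', p ≫ g' = g) ∧
      Epi (L.map p) ∧ L.map d ≫ L.map p = 0 ∧
      (∀ (T : D) (g : L.obj P₀ ⟶ T), L.map d ≫ g = 0 → ∃ g', L.map p ≫ g' = g))
    (hR : ∀ Y : D, ∃ (I₀ I₁ : D) (d : I₀ ⟶ I₁) (i : Y ⟶ I₀), Injective I₀ ∧ Injective I₁ ∧
      i ≫ d = 0 ∧ Mono i ∧ (∀ (T : D) (g : T ⟶ I₀), g ≫ d = 0 → ∃ g', g' ≫ i = g) ∧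
      Mono (R.map i) ∧ R.map i ≫ R.map d = 0 ∧
      (∀ (T : C) (g : T ⟶ R.obj I₀), g ≫ R.map d = 0 → ∃ g', g' ≫ R.map i = g)) :
    Nonempty (L ⊣ R) := by
  let T : ∀ {X : C} {Y : D}, (L.obj X ⟶ Y) → (X ⟶ R.obj Y) → Prop := fun {X Y} a b =>
    ∀ (P : C) (I : D) (_ : Projective P) (_ : Injective I) (p : P ⟶ X) (i : Y ⟶ I),
      S (L.map p ≫ a ≫ i) (p ≫ b ≫ R.map i)
  have T_pre : ∀ {X' X : C} {Y : D} (x : X' ⟶ X) (a : L.obj X ⟶ Y) (b : X ⟶ R.obj Y),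
      T a b → T (L.map x ≫ a) (x ≫ b) := by
    intro X' X Y x a b h P I _ _ p i
    simpa using h P I ‹_› ‹_› (p ≫ x) i
  have T_post : ∀ {X : C} {Y Y' : D} (y : Y ⟶ Y') (a : L.obj X ⟶ Y) (b : X ⟶ R.obj Y),
      T a b → T (a ≫ y) (b ≫ R.map y) := by
    intro X Y Y' y a b h P I _ _ p i
    simpa using h P I ‹_› ‹_› p (y ≫ i)
  -- it suffices to test on one presentation
  have T_of : ∀ {X : C} {Y : D} (a : L.obj X ⟶ Y) (b : X ⟶ R.obj Y) (P : C) (I : D)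
      (p : P ⟶ X) (i : Y ⟶ I) [Epi p] [Mono i],
      S (L.map p ≫ a ≫ i) (p ≫ b ≫ R.map i) → T a b := by
    intro X Y a b P I p i _ _ h P' I' _ _ p' i'
    have h2 := S_pre (Projective.factorThru p' p) _ _
      (S_post (Injective.factorThru i' i) _ _ h)
    simp only [Category.assoc, Injective.comp_factorThru, ← Functor.map_comp] at h2
    rw [← Functor.map_comp_assoc, ← Category.assoc (Projective.factorThru p' p) p,
      Projective.factorThru_comp] at h2
    exact h2
  have T_ex : ∀ {X : C} {Y : D} (a : L.obj X ⟶ Y), ∃ b, T a b := by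
    intro X Y a
    obtain ⟨P₁, P₀, d, p, _, _, w, _, desc, -, w', -⟩ := hL X
    obtain ⟨I₀, I₁, e, i, _, _, v, _, -, _, -, lift⟩ := hR Y
    obtain ⟨b₀, hb₀⟩ := S_ex (L.map p ≫ a ≫ i)
    obtain ⟨b₁, hb₁⟩ := lift _ b₀ (by
      refine S_un 0 _ _ ?_ (S_zero _ _)
      have := S_post e _ _ hb₀
      simpa [v] using this)
    obtain ⟨b, hb⟩ := desc _ b₁ (by
      rw [← cancel_mono (R.map i), zero_comp]
      refine S_un 0 _ _ ?_ (S_zero _ _)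
      have := S_pre d _ _ hb₀
      rw [reassoc_of% w', zero_comp, ← hb₁] at this
      simpa using this)
    refine ⟨b, T_of a b _ _ p i ?_⟩
    rw [reassoc_of% hb, hb₁]
    exact hb₀
  have T_ex' : ∀ {X : C} {Y : D} (b : X ⟶ R.obj Y), ∃ a : L.obj X ⟶ Y, T a b := by
    intro X Y b
    obtain ⟨P₁, P₀, d, p, _, _, w, _, -, _, w', desc⟩ := hL X
    obtain ⟨I₀, I₁, e, i, _, _, v, _, lift, _, v', -⟩ := hR Y
    obtain ⟨a₀, ha₀⟩ := S_ex' (p ≫ b ≫ R.map i)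
    obtain ⟨a₁, ha₁⟩ := desc _ a₀ (by
      refine S_un' _ _ 0 ?_ (S_zero _ _)
      have := S_pre d _ _ ha₀
      simpa [reassoc_of% w] using this)
    obtain ⟨a, ha⟩ := lift _ a₁ (by
      rw [← cancel_epi (L.map p), comp_zero]
      refine S_un' _ _ 0 ?_ (S_zero _ _)
      have := S_post e _ _ ha₀
      simpa [v', ← ha₁] using this)
    refine ⟨a, T_of a b _ _ p i ?_⟩
    rw [ha, ha₁]
    exact ha₀
  have T_un : ∀ {X : C} {Y : D} (a : L.obj X ⟶ Y) (b b'), T a b → T a b' → b = b' := by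
    intro X Y a b b' h h'
    obtain ⟨P₁, P₀, d, p, _, _, w, _, -⟩ := hL X
    obtain ⟨I₀, I₁, e, i, _, _, v, _, -, _, -⟩ := hR Y
    rw [← cancel_epi p, ← cancel_mono (R.map i), Category.assoc, Category.assoc]
    exact S_un _ _ _ (h _ _ ‹_› ‹_› p i) (h' _ _ ‹_› ‹_› p i)
  have T_un' : ∀ {X : C} {Y : D} (a a' : L.obj X ⟶ Y) (b), T a b → T a' b → a = a' := by
    intro X Y a a' b h h'
    obtain ⟨P₁, P₀, d, p, _, _, w, _, -, _, -⟩ := hL X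
    obtain ⟨I₀, I₁, e, i, _, _, v, _, -⟩ := hR Y
    rw [← cancel_epi (L.map p), ← cancel_mono i, Category.assoc, Category.assoc]
    exact S_un' _ _ _ (h _ _ ‹_› ‹_› p i) (h' _ _ ‹_› ‹_› p i)
  choose u hu using @T_ex
  choose v hv using @T_ex'
  exact ⟨Adjunction.mkOfHomEquiv
    { homEquiv := fun X Y =>
        { toFun := fun a => u a
          invFun := fun b => v b
          left_inv := fun a => T_un' _ _ _ (hv _) (hu _)
          right_inv := fun b => T_un _ _ _ (hu _) (hv _) }
      homEquiv_naturality_left_symm := fun f g => T_un' _ _ _ (hv _) (T_pre _ _ _ (hv _))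
      homEquiv_naturality_right := fun f g => T_un _ _ _ (hu _) (T_post _ _ _ (hu _)) }⟩

/-- Let `C`, `D` be abelian categories with enough projectives resp.
injectives, `F, G : C ⥤ D` functors with right adjoints `F', G'`, `α : F ⟶ G` a natural
transformation with mate `α' : G' ⟶ F'`.  Let `K := ker α` (in `C ⥤ D`) and
`Q := coker α'` (in `D ⥤ C`).  Then the zeroth left derived functor `L₀K` is left adjoint
to the zeroth right derived functor `R⁰Q`. -/
theorem zerothLeftDerived_kernel_adjoint_zerothRightDerived_cokernel
    {C : Type*} [Category C] {D : Type*} [Category D] [Abelian C] [Abelian D]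
    [EnoughProjectives C] [EnoughInjectives D]
    {F G : C ⥤ D} {F' G' : D ⥤ C} (adjF : F ⊣ F') (adjG : G ⊣ G')
    (α : F ⟶ G)
    [(kernel α).Additive] [(cokernel (conjugateEquiv adjG adjF α)).Additive] :
    Nonempty ((kernel α).leftDerived 0 ⊣
      (cokernel (conjugateEquiv adjG adjF α)).rightDerived 0) := by
  have hpF : F.Additive := by
    have : PreservesColimitsOfSize.{0, 0} F := adjF.leftAdjoint_preservesColimits
    have : PreservesBinaryBiproducts F := preservesBinaryBiproducts_of_preservesBinaryCoproducts F
    exact Functor.additive_of_preservesBinaryBiproducts F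
  have hmate : ∀ (P : C) (I : D) (k : G.obj P ⟶ I), adjF.homEquiv P I (α.app P ≫ k) =
      adjG.homEquiv P I k ≫ (conjugateEquiv adjG adjF α).app I := by
    intro P I k
    have h := unit_conjugateEquiv adjG adjF α P
    rw [Adjunction.homEquiv_unit, Adjunction.homEquiv_unit, Functor.map_comp, ← reassoc_of% h,
      Category.assoc, NatTrans.naturality]
  generalize hα' : conjugateEquiv adjG adjF α = α' at *
  let ε : ((kernel α).leftDerived 0) ⟶ F := (kernel α).fromLeftDerivedZero ≫ kernel.ι α
  let η : F' ⟶ ((cokernel α').rightDerived 0) :=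
    cokernel.π α' ≫ (cokernel α').toRightDerivedZero
  refine abstract_adj _ _
    (fun {P I} f g => ∃ h : F.obj P ⟶ I, ε.app P ≫ h = f ∧ adjF.homEquiv P I h ≫ η.app I = g)
    ?_ ?_ ?_ ?_ ?_ ?_ ?_ (left_pres _) (right_pres _)
  · rintro P' P I p _ _ ⟨h, rfl, rfl⟩
    refine ⟨F.map p ≫ h, ?_, ?_⟩
    · rw [NatTrans.naturality_assoc]
    · rw [Adjunction.homEquiv_naturality_left, Category.assoc]
  · rintro P I I' i _ _ ⟨h, rfl, rfl⟩
    refine ⟨h ≫ i, ?_, ?_⟩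
    · rw [Category.assoc]
    · rw [Adjunction.homEquiv_naturality_right, Category.assoc, Category.assoc, NatTrans.naturality]
  · intro P I
    exact ⟨0, by simp, by simp⟩
  · intro P I _ _ f
    have : Mono ((kernel.ι α).app P) := inferInstance
    refine ⟨_, Injective.factorThru (inv ((kernel α).fromLeftDerivedZero.app P) ≫ f)
      ((kernel.ι α).app P), ?_, rfl⟩
    simp [ε]
  · intro P I _ _ g
    have : Epi ((cokernel.π α').app I) := inferInstance
    refine ⟨_, (adjF.homEquiv P I).symm (Projective.factorThru
      (g ≫ inv ((cokernel α').toRightDerivedZero.app I)) ((cokernel.π α').app I)), rfl, ?_⟩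
    simp [η]
  · rintro P I _ _ _ _ _ ⟨h, e, rfl⟩ ⟨h', e', rfl⟩
    have w : (kernel.ι α).app P ≫ (h - h') = 0 := by
      rw [← cancel_epi ((kernel α).fromLeftDerivedZero.app P)]
      have := e.trans e'.symm
      simp only [ε, NatTrans.comp_app, Category.assoc] at this
      simp [Preadditive.comp_sub, this]
    obtain ⟨k, hk⟩ := ker_desc α P I (h - h') w
    rw [← sub_eq_zero, ← Preadditive.sub_comp, ← adjF.homAddEquiv_sub, ← hk, hmate]
    have hc : α'.app I ≫ (cokernel.π α').app I = 0 := by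
      rw [← NatTrans.comp_app, cokernel.condition]; rfl
    simp [η, reassoc_of% hc]
  · rintro P I _ _ _ _ _ ⟨h, rfl, e⟩ ⟨h', rfl, e'⟩
    have w : adjF.homEquiv P I (h - h') ≫ (cokernel.π α').app I = 0 := by
      rw [← cancel_mono ((cokernel α').toRightDerivedZero.app I)]
      have := e.trans e'.symm
      simp only [η, NatTrans.comp_app] at this
      simp [Preadditive.sub_comp, this]
    obtain ⟨k, hk⟩ := coker_lift α' I P _ w
    obtain ⟨k, rfl⟩ := (adjG.homEquiv P I).surjective k
    rw [← hmate] at hk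
    have hk := (adjF.homEquiv P I).injective hk
    rw [← sub_eq_zero, ← Preadditive.comp_sub, ← hk]
    have hc : (kernel.ι α).app P ≫ α.app P = 0 := by
      rw [← NatTrans.comp_app, kernel.condition]; rfl
    simp [ε, reassoc_of% hc]
end

section
/- Let I be an ideal functor on an abelian category C, with projection π : 𝟭_C ⟶ T_I and right adjoint T_I^∨, and let ι^∨ : T_I^∨ ⟶ 𝟭_C denote the mate of π, which is a monomorphism. Then: (1) for every object X of C, the two morphisms π at T_I(X) and T_I applied to π at X, both from T_I(X) to T_I(T_I(X)), coincide and are isomorphisms, so T_I ∘ T_I ≅ T_I; (2) for every X, the component of ι^∨ at T_I(X) is an isomorphism T_I^∨(T_I(X)) ≅ T_I(X), so T_I^∨ ∘ T_I ≅ T_I; (3) consequently, the subobject I evaluated at any object of the form T_I(X) is zero, i.e. I(T_I(X)) = 0. -/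
open CategoryTheory CategoryTheory.Limits

/-- Let `I` be an ideal functor on an abelian category `C`, i.e. a
subfunctor `ι : I ⟶ 𝟭 C` of the identity whose cokernel `T_I := coker ι`, with projection
`π := cokernel.π ι`, admits a right adjoint `T'`; let `ι' : T' ⟶ 𝟭 C` be the mate of `π`.
Then for every object `X`: (1) `π` at `T_I X` equals `T_I` applied to `π` at `X`, and this
morphism is an isomorphism (so `T_I ∘ T_I ≅ T_I`); (2) the component of `ι'` at `T_I X` is
an isomorphism (so `T' ∘ T_I ≅ T_I`); (3) `I (T_I X) = 0`. -/
theorem ideal_functor_cokernel_idempotent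
    {C : Type*} [Category C] [Abelian C]
    (I : C ⥤ C) (ι : I ⟶ 𝟭 C) [Mono ι]
    (T' : C ⥤ C) (adj : cokernel ι ⊣ T') :
    ∀ X : C,
      ((cokernel.π ι).app ((cokernel ι).obj X) =
          (cokernel ι).map ((cokernel.π ι).app X)) ∧
      IsIso ((cokernel.π ι).app ((cokernel ι).obj X)) ∧
      IsIso ((conjugateEquiv adj Adjunction.id (cokernel.π ι)).app ((cokernel ι).obj X)) ∧
      IsZero (I.obj ((cokernel ι).obj X)) := by
  intro X
  have key : ∀ Y, (conjugateEquiv adj Adjunction.id (cokernel.π ι)).app Y =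
      (cokernel.π ι).app (T'.obj Y) ≫ adj.counit.app Y := by
    intro Y
    rw [conjugateEquiv_apply_app]
    simp [Adjunction.id]
  have nat : ∀ {A B : C} (f : A ⟶ B), f ≫ (cokernel.π ι).app B =
      (cokernel.π ι).app A ≫ (cokernel ι).map f := by
    intro A B f
    simpa using (cokernel.π ι).naturality f
  have epi : ∀ Y, Epi ((cokernel.π ι).app Y) := fun Y => inferInstance
  have mono : ∀ Y, Mono ((conjugateEquiv adj Adjunction.id (cokernel.π ι)).app Y) := by
    intro Y
    rw [key]
    constructor
    intro Z g h e
    have e' : g ≫ (cokernel.π ι).app (T'.obj Y) ≫ adj.counit.app Y =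
        h ≫ (cokernel.π ι).app (T'.obj Y) ≫ adj.counit.app Y := e
    rw [← Category.assoc, ← Category.assoc, nat, nat, Category.assoc, Category.assoc] at e'
    have e2 := (epi Z).left_cancellation _ _ e'
    apply (adj.homEquiv Z Y).symm.injective
    rw [Adjunction.homEquiv_counit, Adjunction.homEquiv_counit]
    exact e2
  have isoT : IsIso ((conjugateEquiv adj Adjunction.id (cokernel.π ι)).app
      ((cokernel ι).obj X)) := by
    have h : adj.unit.app X ≫ (conjugateEquiv adj Adjunction.id (cokernel.π ι)).app
        ((cokernel ι).obj X) = (cokernel.π ι).app X := by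
      rw [key, ← Category.assoc]
      erw [nat, Category.assoc, adj.left_triangle_components, Category.comp_id]
      rfl
    have := mono ((cokernel ι).obj X)
    have : Epi ((conjugateEquiv adj Adjunction.id (cokernel.π ι)).app
        ((cokernel ι).obj X)) := by
      have : Epi (adj.unit.app X ≫ (conjugateEquiv adj Adjunction.id (cokernel.π ι)).app
        ((cokernel ι).obj X)) := by rw [h]; exact epi X
      exact epi_of_epi (adj.unit.app X) _
    exact isIso_of_mono_of_epi _
  have isoP : IsIso ((cokernel.π ι).app ((cokernel ι).obj X)) := by
    have h1 : Mono ((cokernel.π ι).app (T'.obj ((cokernel ι).obj X))) := by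
      have := mono ((cokernel ι).obj X)
      rw [key] at this
      exact mono_of_mono _ (adj.counit.app ((cokernel ι).obj X))
    have h2 : IsIso ((cokernel.π ι).app (T'.obj ((cokernel ι).obj X))) :=
      isIso_of_mono_of_epi _
    let e : T'.obj ((cokernel ι).obj X) ≅ (cokernel ι).obj X :=
      @asIso _ _ _ _ _ isoT
    exact (NatTrans.isIso_app_iff_of_iso (cokernel.π ι) e).1 h2
  refine ⟨?_, isoP, isoT, ?_⟩
  · exact (epi X).left_cancellation _ _ (nat ((cokernel.π ι).app X))
  · have h0 : ι.app ((cokernel ι).obj X) = 0 := by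
      have h : ι.app ((cokernel ι).obj X) ≫ (cokernel.π ι).app ((cokernel ι).obj X) = 0 := by
        rw [← NatTrans.comp_app, cokernel.condition]
        rfl
      exact (cancel_mono ((cokernel.π ι).app ((cokernel ι).obj X))).1 (by rw [h, zero_comp])
    have : Mono (ι.app ((cokernel ι).obj X)) := inferInstance
    exact IsZero.of_mono_eq_zero _ h0
end

section
/- Let A and B be rings and (M, N, η, ρ) a Morita context between A and B with trace ideals I ⊆ A and J ⊆ B. For a left B-module W, let DW denote the image of the A-linear map M ⊗_B W → Hom_B(N, W) sending m ⊗ w to the map n ↦ ρ(n ⊗ m)·w. Then for every simple left B-module W with J·W = W, the left A-module DW is simple and satisfies I·DW = DW; and the assignment W ↦ DW induces a bijection between the set of isomorphism classes of simple left B-modules W with J·W = W and the set of isomorphism classes of simple left A-modules V with I·V = V. -/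
open MulOpposite

universe u

section MoritaSetup

variable (A B M N : Type u) [Ring A] [Ring B]
  [AddCommGroup M] [AddCommGroup N]
  [Module A M] [Module Bᵐᵒᵖ M] [SMulCommClass A Bᵐᵒᵖ M]
  [Module B N] [Module Aᵐᵒᵖ N] [SMulCommClass B Aᵐᵒᵖ N]

/-- A Morita context between rings `A` and `B`: an `(A,B)`-bimodule `M`, a `(B,A)`-bimodule
`N`, and bimodule homomorphisms `η : M ⊗[B] N → A`, `ρ : N ⊗[A] M → B` satisfying the
associativity laws.  The maps on tensor products are presented by their equivalent data of
balanced biadditive pairings `eta : M → N → A` and `rho : N → M → B`. -/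
structure MoritaPairing where
  eta : M → N → A
  rho : N → M → B
  eta_add_left : ∀ m m' n, eta (m + m') n = eta m n + eta m' n
  eta_add_right : ∀ m n n', eta m (n + n') = eta m n + eta m n'
  eta_smul_left : ∀ (a : A) m n, eta (a • m) n = a * eta m n
  eta_smul_right : ∀ (a : A) m n, eta m (op a • n) = eta m n * a
  eta_balanced : ∀ (b : B) m n, eta (op b • m) n = eta m (b • n)
  rho_add_left : ∀ n n' m, rho (n + n') m = rho n m + rho n' m
  rho_add_right : ∀ n m m', rho n (m + m') = rho n m + rho n m'
  rho_smul_left : ∀ (b : B) n m, rho (b • n) m = b * rho n m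
  rho_smul_right : ∀ (b : B) n m, rho n (op b • m) = rho n m * b
  rho_balanced : ∀ (a : A) n m, rho (op a • n) m = rho n (a • m)
  assoc_M : ∀ m n m', eta m n • m' = op (rho n m') • m
  assoc_N : ∀ n m n', rho n m • n' = op (eta m n') • n

variable {A B M N}

section HomModule

variable (W : Type u) [AddCommGroup W] [Module B W]

/-- `Hom_B(N, W)` is a left `A`-module via the right `A`-action on `N`:
`(a • ψ) n = ψ (n · a)`. -/
instance instSMulHomDom : SMul A (N →ₗ[B] W) :=
  ⟨fun a ψ =>
    { toFun := fun n => ψ (op a • n)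
      map_add' := fun x y => by
        show ψ (op a • (x + y)) = ψ (op a • x) + ψ (op a • y)
        rw [smul_add, map_add]
      map_smul' := fun b x => by
        show ψ (op a • (b • x)) = b • ψ (op a • x)
        rw [← smul_comm, map_smul] }⟩

theorem domSMul_apply (a : A) (ψ : N →ₗ[B] W) (n : N) : (a • ψ) n = ψ (op a • n) := rfl

instance instModuleHomDom : Module A (N →ₗ[B] W) where
  one_smul ψ := by ext n; simp [domSMul_apply]
  mul_smul a a' ψ := by ext n; simp [domSMul_apply, op_mul, mul_smul]
  smul_zero a := by ext n; simp [domSMul_apply]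
  smul_add a ψ φ := by ext n; simp [domSMul_apply]
  add_smul a a' ψ := by ext n; simp [domSMul_apply, op_add, add_smul]
  zero_smul ψ := by ext n; simp [domSMul_apply]

end HomModule

variable (P : MoritaPairing A B M N)

/-- `D W`: the image of the `A`-linear map `M ⊗[B] W → Hom_B(N, W)`,
`m ⊗ w ↦ (n ↦ ρ(n ⊗ m) • w)`; equivalently, the `A`-span of the maps `n ↦ ρ(n ⊗ m) • w`. -/
def DSub (W : Type u) [AddCommGroup W] [Module B W] : Submodule A (N →ₗ[B] W) :=
  Submodule.span A {ψ : N →ₗ[B] W | ∃ (m : M) (w : W), ∀ n : N, ψ n = P.rho n m • w}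

/-- `J • W = W`, where `J = im ρ ⊆ B` is the trace ideal. -/
def JFull (W : Type u) [AddCommGroup W] [Module B W] : Prop :=
  Submodule.span B {x : W | ∃ (n : N) (m : M) (w : W), x = P.rho n m • w} = ⊤

/-- `I • V = V`, where `I = im η ⊆ A` is the trace ideal. -/
def IFull (V : Type u) [AddCommGroup V] [Module A V] : Prop :=
  Submodule.span A {x : V | ∃ (m : M) (n : N) (v : V), x = P.eta m n • v} = ⊤

/-- Isomorphism classes of simple `B`-modules `W` with `J • W = W`. -/
def setoidB : Setoid {W : ModuleCat.{u} B // IsSimpleModule B W ∧ JFull P W} where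
  r W W' := Nonempty (↥W.1 ≃ₗ[B] ↥W'.1)
  iseqv := ⟨fun _ => ⟨LinearEquiv.refl _ _⟩, fun ⟨e⟩ => ⟨e.symm⟩, fun ⟨e⟩ ⟨f⟩ => ⟨e.trans f⟩⟩

/-- Isomorphism classes of simple `A`-modules `V` with `I • V = V`. -/
def setoidA : Setoid {V : ModuleCat.{u} A // IsSimpleModule A V ∧ IFull P V} where
  r V V' := Nonempty (↥V.1 ≃ₗ[A] ↥V'.1)
  iseqv := ⟨fun _ => ⟨LinearEquiv.refl _ _⟩, fun ⟨e⟩ => ⟨e.symm⟩, fun ⟨e⟩ ⟨f⟩ => ⟨e.trans f⟩⟩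

/-- The opposite Morita context. -/
def MoritaPairing.swap (P : MoritaPairing A B M N) : MoritaPairing B A N M where
  eta := P.rho
  rho := P.eta
  eta_add_left := P.rho_add_left
  eta_add_right := P.rho_add_right
  eta_smul_left := P.rho_smul_left
  eta_smul_right := P.rho_smul_right
  eta_balanced := P.rho_balanced
  rho_add_left := P.eta_add_left
  rho_add_right := P.eta_add_right
  rho_smul_left := P.eta_smul_left
  rho_smul_right := P.eta_smul_right
  rho_balanced := P.eta_balanced
  assoc_M := P.assoc_N
  assoc_N := P.assoc_M

/-- A pairing linking an `A`-module `V` with a `B`-module `W`. -/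
structure MLink (P : MoritaPairing A B M N) (V W : Type u) [AddCommGroup V] [Module A V]
    [AddCommGroup W] [Module B W] where
  f : M → W → V
  g : N → V → W
  f_add_left : ∀ m m' w, f (m + m') w = f m w + f m' w
  f_add_right : ∀ m w w', f m (w + w') = f m w + f m w'
  f_smul : ∀ (a : A) m w, f (a • m) w = a • f m w
  f_bal : ∀ (b : B) m w, f (op b • m) w = f m (b • w)
  g_add_left : ∀ n n' v, g (n + n') v = g n v + g n' v
  g_add_right : ∀ n v v', g n (v + v') = g n v + g n v'
  g_smul : ∀ (b : B) n v, g (b • n) v = b • g n v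
  g_bal : ∀ (a : A) n v, g (op a • n) v = g n (a • v)
  fg : ∀ m n v, f m (g n v) = P.eta m n • v
  gf : ∀ n m w, g n (f m w) = P.rho n m • w

/-- Symmetry of links. -/
def MLink.swap {P : MoritaPairing A B M N} {V W : Type u} [AddCommGroup V] [Module A V]
    [AddCommGroup W] [Module B W] (L : MLink P V W) : MLink P.swap W V where
  f := L.g
  g := L.f
  f_add_left := L.g_add_left
  f_add_right := L.g_add_right
  f_smul := L.g_smul
  f_bal := L.g_bal
  g_add_left := L.f_add_left
  g_add_right := L.f_add_right
  g_smul := L.f_smul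
  g_bal := L.f_bal
  fg := L.gf
  gf := L.fg

/-- Transport of links along an isomorphism of the `B`-module. -/
def MLink.congrB {P : MoritaPairing A B M N} {V W W' : Type u} [AddCommGroup V] [Module A V]
    [AddCommGroup W] [Module B W] [AddCommGroup W'] [Module B W']
    (L : MLink P V W) (e : W ≃ₗ[B] W') : MLink P V W' where
  f m w := L.f m (e.symm w)
  g n v := e (L.g n v)
  f_add_left _ _ _ := L.f_add_left _ _ _
  f_add_right _ _ _ := by rw [map_add, L.f_add_right]
  f_smul _ _ _ := L.f_smul _ _ _
  f_bal _ _ _ := by rw [map_smul, L.f_bal]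
  g_add_left _ _ _ := by rw [L.g_add_left, map_add]
  g_add_right _ _ _ := by rw [L.g_add_right, map_add]
  g_smul _ _ _ := by rw [L.g_smul, map_smul]
  g_bal _ _ _ := by rw [L.g_bal]
  fg _ _ _ := by rw [e.symm_apply_apply, L.fg]
  gf _ _ _ := by rw [L.gf, map_smul, e.apply_symm_apply]

/-- The generator `n ↦ ρ(n ⊗ m) • w` of `DSub P W`. -/
def genHom (P : MoritaPairing A B M N) {W : Type u} [AddCommGroup W] [Module B W]
    (m : M) (w : W) : N →ₗ[B] W where
  toFun n := P.rho n m • w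
  map_add' n n' := by rw [P.rho_add_left, add_smul]
  map_smul' b n := by rw [P.rho_smul_left, mul_smul]; rfl

theorem genHom_apply (P : MoritaPairing A B M N) {W : Type u} [AddCommGroup W] [Module B W]
    (m : M) (w : W) (n : N) : genHom P m w n = P.rho n m • w := rfl

theorem genHom_mem (P : MoritaPairing A B M N) {W : Type u} [AddCommGroup W] [Module B W]
    (m : M) (w : W) : genHom P m w ∈ DSub P W :=
  Submodule.subset_span ⟨m, w, fun _ => rfl⟩

theorem DSub_le (P : MoritaPairing A B M N) {W : Type u} [AddCommGroup W] [Module B W]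
    (S : Submodule A (N →ₗ[B] W)) (h : ∀ m w, genHom P m w ∈ S) : DSub P W ≤ S := by
  refine Submodule.span_le.2 ?_
  rintro ψ ⟨m, w, hψ⟩
  have : ψ = genHom P m w := LinearMap.ext hψ
  rw [this]
  exact h m w

theorem genHom_eval (P : MoritaPairing A B M N) {W : Type u} [AddCommGroup W] [Module B W]
    (m : M) (n : N) (ψ : N →ₗ[B] W) : genHom P m (ψ n) = P.eta m n • ψ := by
  ext n'
  rw [genHom_apply, domSMul_apply, ← map_smul, P.assoc_N]

/-- `D W` is linked with `W`. -/
def linkD (P : MoritaPairing A B M N) (W : Type u) [AddCommGroup W] [Module B W] :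
    MLink P (DSub P W) W where
  f m w := ⟨genHom P m w, genHom_mem P m w⟩
  g n ψ := ψ.1 n
  f_add_left m m' w := by
    ext n
    change P.rho n (m + m') • w = P.rho n m • w + P.rho n m' • w
    rw [P.rho_add_right, add_smul]
  f_add_right m w w' := by
    ext n
    exact smul_add _ _ _
  f_smul a m w := by
    ext n
    change P.rho n (a • m) • w = P.rho (op a • n) m • w
    rw [P.rho_balanced]
  f_bal b m w := by
    ext n
    change P.rho n (op b • m) • w = P.rho n m • b • w
    rw [P.rho_smul_right, mul_smul]
  g_add_left n n' ψ := map_add _ _ _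
  g_add_right n ψ ψ' := rfl
  g_smul b n ψ := map_smul _ _ _
  g_bal a n ψ := rfl
  fg m n ψ := Subtype.ext (genHom_eval P m n ψ.1)
  gf n m w := rfl

theorem JFull.exists_ne {P : MoritaPairing A B M N} {W : Type u} [AddCommGroup W] [Module B W]
    [Nontrivial W] (h : JFull P W) : ∃ n m, ∃ w : W, P.rho n m • w ≠ 0 := by
  by_contra! hc
  unfold JFull at h
  have : Submodule.span B {x : W | ∃ (n : N) (m : M) (w : W), x = P.rho n m • w} = ⊥ := by
    rw [Submodule.span_eq_bot]
    rintro x ⟨n, m, w, rfl⟩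
    exact hc n m w
  rw [this] at h
  exact bot_ne_top h

theorem hom_surj {W : Type u} [AddCommGroup W] [Module B W] [IsSimpleModule B W]
    (ψ : N →ₗ[B] W) (h : ψ ≠ 0) : Function.Surjective ψ :=
  ψ.surjective_or_eq_zero.resolve_right h

theorem DSub_le_of_mem (P : MoritaPairing A B M N) {W : Type u} [AddCommGroup W] [Module B W]
    [IsSimpleModule B W] (S : Submodule A (N →ₗ[B] W)) (ψ : N →ₗ[B] W) (h : ψ ≠ 0)
    (hS : ψ ∈ S) : DSub P W ≤ S := by
  refine DSub_le P S fun m w => ?_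
  obtain ⟨n, rfl⟩ := hom_surj ψ h w
  rw [genHom_eval]
  exact S.smul_mem _ hS

theorem DSub_exists_ne (P : MoritaPairing A B M N) {W : Type u} [AddCommGroup W] [Module B W]
    [IsSimpleModule B W] (h : JFull P W) : ∃ ψ ∈ DSub P W, ψ ≠ 0 := by
  have := IsSimpleModule.nontrivial B W
  obtain ⟨n, m, w, hne⟩ := h.exists_ne
  exact ⟨genHom P m w, genHom_mem P m w, fun h0 => hne (by rw [← genHom_apply, h0]; rfl)⟩

theorem DSub_simple (P : MoritaPairing A B M N) (W : Type u) [AddCommGroup W] [Module B W]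
    [IsSimpleModule B W] (h : JFull P W) : IsSimpleModule A (DSub P W) := by
  rw [isSimpleModule_iff_isAtom]
  refine ⟨?_, ?_⟩
  · obtain ⟨ψ, hm, h0⟩ := DSub_exists_ne P h
    exact (Submodule.ne_bot_iff _).2 ⟨ψ, hm, h0⟩
  · intro S hS
    by_contra hb
    obtain ⟨ψ, hm, h0⟩ := (Submodule.ne_bot_iff _).1 hb
    exact absurd (DSub_le_of_mem P S ψ h0 hm) (not_le_of_gt hS)

theorem DSub_IFull (P : MoritaPairing A B M N) (W : Type u) [AddCommGroup W] [Module B W]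
    [IsSimpleModule B W] (h : JFull P W) : IFull P (DSub P W) := by
  obtain ⟨ψ, hm, h0⟩ := DSub_exists_ne P h
  unfold IFull
  set T := Submodule.span A
    {x : DSub P W | ∃ (m : M) (n : N) (v : DSub P W), x = P.eta m n • v} with hT
  have key : DSub P W ≤ T.map (DSub P W).subtype := by
    refine DSub_le P _ fun m w => ?_
    obtain ⟨n, rfl⟩ := hom_surj ψ h0 w
    rw [genHom_eval]
    exact ⟨P.eta m n • ⟨ψ, hm⟩, Submodule.subset_span ⟨m, n, ⟨ψ, hm⟩, rfl⟩, rfl⟩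
  rw [eq_top_iff]
  rintro x -
  obtain ⟨y, hy, hyx⟩ := key x.2
  have : y = x := Subtype.ext hyx
  rwa [← this]

/-- Linked simple full modules: `V ≅ D W`. -/
theorem MLink.equiv {P : MoritaPairing A B M N} {V W : Type u} [AddCommGroup V] [Module A V]
    [AddCommGroup W] [Module B W] [IsSimpleModule A V] [IsSimpleModule B W]
    (L : MLink P V W) (hV : IFull P V) (hW : JFull P W) : Nonempty (V ≃ₗ[A] DSub P W) := by
  have hnt := IsSimpleModule.nontrivial A V
  let φ : V →ₗ[A] (N →ₗ[B] W) :=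
    { toFun := fun v =>
        { toFun := fun n => L.g n v
          map_add' := fun n n' => L.g_add_left n n' v
          map_smul' := fun b n => L.g_smul b n v }
      map_add' := fun v v' => LinearMap.ext fun n => L.g_add_right n v v'
      map_smul' := fun a v => LinearMap.ext fun n => (L.g_bal a n v).symm }
  have hφ : ∀ v n, φ v n = L.g n v := fun _ _ => rfl
  have f0 : ∀ m, L.f m 0 = 0 := fun m => by simpa using L.f_add_right m 0 0
  have hne : φ ≠ 0 := by
    intro h0
    have hV' : JFull P.swap V := hV
    obtain ⟨m, n, v, h⟩ := hV'.exists_ne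
    apply h
    change P.eta m n • v = 0
    rw [← L.fg, ← hφ, h0]
    exact f0 m
  have hinj : Function.Injective φ := φ.injective_or_eq_zero.resolve_right hne
  have e := LinearEquiv.ofInjective φ hinj
  have hat : IsAtom (LinearMap.range φ) := by
    rw [← isSimpleModule_iff_isAtom]
    exact IsSimpleModule.congr e.symm
  have hle : DSub P W ≤ LinearMap.range φ := by
    refine DSub_le P _ fun m w => ⟨L.f m w, ?_⟩
    ext n
    rw [hφ, L.gf, genHom_apply]
  have hb : DSub P W ≠ ⊥ := by
    obtain ⟨ψ, hm, h0⟩ := DSub_exists_ne P hW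
    exact (Submodule.ne_bot_iff _).2 ⟨ψ, hm, h0⟩
  have heq : DSub P W = LinearMap.range φ := (hat.le_iff.1 hle).resolve_left hb
  exact ⟨e.trans (LinearEquiv.ofEq _ _ heq.symm)⟩

/-- For a Morita context `(M, N, η, ρ)` between rings `A` and `B` with
trace ideals `I ⊆ A`, `J ⊆ B`: for every simple `B`-module `W` with `J•W = W` the
`A`-module `D W` is simple with `I•(D W) = D W`, and `W ↦ D W` induces a bijection between
isomorphism classes of simple `B`-modules with `J•W = W` and isomorphism classes of simple
`A`-modules with `I•V = V`. -/
theorem moritaContext_simple_correspondence :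
    (∀ (W : Type u) [AddCommGroup W] [Module B W],
        IsSimpleModule B W → JFull P W →
          IsSimpleModule A (DSub P W) ∧ IFull P (DSub P W)) ∧
    ∃ e : Quotient (setoidB P) ≃ Quotient (setoidA P),
      ∀ (W : ModuleCat.{u} B) (h : IsSimpleModule B W ∧ JFull P W),
        ∃ hD : IsSimpleModule A (ModuleCat.of A (DSub P W)) ∧
            IFull P (ModuleCat.of A (DSub P W)),
          e (Quotient.mk (setoidB P) ⟨W, h⟩) =
            Quotient.mk (setoidA P) ⟨ModuleCat.of A (DSub P W), hD⟩ := by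
  have h1 : ∀ (W : Type u) [AddCommGroup W] [Module B W],
        IsSimpleModule B W → JFull P W →
          IsSimpleModule A (DSub P W) ∧ IFull P (DSub P W) :=
    fun W _ _ _ hJ => ⟨DSub_simple P W hJ, DSub_IFull P W hJ⟩
  refine ⟨h1, ?_⟩
  let F : {W : ModuleCat.{u} B // IsSimpleModule B W ∧ JFull P W} →
      {V : ModuleCat.{u} A // IsSimpleModule A V ∧ IFull P V} :=
    fun W => ⟨ModuleCat.of A (DSub P W.1), h1 W.1 W.2.1 W.2.2⟩
  have hF : ∀ W W', (setoidB P).r W W' → (setoidA P).r (F W) (F W') := by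
    rintro ⟨W, hW, hJ⟩ ⟨W', hW', hJ'⟩ ⟨e⟩
    have := (h1 W hW hJ).1
    exact ((linkD P W).congrB e).equiv (h1 W hW hJ).2 hJ'
  let q : Quotient (setoidB P) → Quotient (setoidA P) :=
    Quotient.map F hF
  have hq : Function.Bijective q := by
    constructor
    · rintro ⟨W, hW, hJ⟩ ⟨W', hW', hJ'⟩ h
      obtain ⟨e⟩ : Nonempty (DSub P W ≃ₗ[A] DSub P W') := Quotient.exact h
      have s := h1 W hW hJ
      have s' := h1 W' hW' hJ'
      have := s.1
      have := s'.1
      obtain ⟨e1⟩ := ((linkD P W).swap.congrB e).equiv (P := P.swap) hJ s'.2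
      obtain ⟨e2⟩ := (linkD P W').swap.equiv (P := P.swap) hJ' s'.2
      exact Quotient.sound ⟨e1.trans e2.symm⟩
    · rintro ⟨V, hV, hI⟩
      have hI' : JFull P.swap V := hI
      have s1 : IsSimpleModule B (DSub P.swap V) := DSub_simple P.swap V hI'
      have s2 : JFull P (DSub P.swap V) := DSub_IFull P.swap V hI'
      refine ⟨Quotient.mk _ ⟨ModuleCat.of B (DSub P.swap V), s1, s2⟩, ?_⟩
      obtain ⟨e⟩ := (linkD P.swap V).swap.equiv (P := P) hI s2
      exact Quotient.sound ⟨e.symm⟩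
  exact ⟨Equiv.ofBijective q hq, fun W h => ⟨h1 W h.1 h.2, rfl⟩⟩
end MoritaSetup
end

section
/- Let A and B be rings with B semisimple, and let (M, N, η, ρ) be a Morita context between A and B such that M is finitely generated projective as a right B-module, N is finitely generated projective as a left B-module, and η is injective. If ρ is surjective, then the trace ideal I := im(η) ⊆ A is generated as a two-sided ideal by an idempotent (there is an idempotent e ∈ A with I = AeA), and I is finitely generated projective both as a left A-module and as a right A-module. -/
open MulOpposite
open scoped TensorProduct

universe u

section MoritaSetup

variable (A B M N : Type u) [Ring A] [Ring B]
  [AddCommGroup M] [AddCommGroup N]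
  [Module A M] [Module Bᵐᵒᵖ M] [SMulCommClass A Bᵐᵒᵖ M]
  [Module B N] [Module Aᵐᵒᵖ N] [SMulCommClass B Aᵐᵒᵖ N]

variable {A B M N}
variable (P : MoritaPairing A B M N)

/-- The pairing `η` as a biadditive map. -/
def etaAddHom : M →+ N →+ A :=
  AddMonoidHom.mk'
    (fun m => AddMonoidHom.mk' (fun n => P.eta m n) (fun n n' => P.eta_add_right m n n'))
    (fun m m' => by ext n; simp [P.eta_add_left])

/-- The map induced by `η` on the `ℤ`-tensor product `M ⊗[ℤ] N`. -/
noncomputable def etaLift : M ⊗[ℤ] N →+ A :=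
  TensorProduct.liftAddHom (etaAddHom P) (fun z m n => by simp [map_zsmul])

/-- The subgroup of balancing relations defining `M ⊗[B] N` as a quotient of
`M ⊗[ℤ] N`; the map `η : M ⊗[B] N → A` is injective iff the kernel of `etaLift` is
contained in this subgroup. -/
noncomputable def balancedRel : AddSubgroup (M ⊗[ℤ] N) :=
  AddSubgroup.closure {x : M ⊗[ℤ] N |
    ∃ (b : B) (m : M) (n : N), x = (op b • m) ⊗ₜ[ℤ] n - m ⊗ₜ[ℤ] (b • n)}

/-- The trace ideal `I = im η ⊆ A`, as a left ideal (it is in fact two-sided). -/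
def traceIdealLeft : Submodule A A :=
  Submodule.span A {a : A | ∃ (m : M) (n : N), a = P.eta m n}

/-- The trace ideal `I = im η ⊆ A`, as a right ideal (it is in fact two-sided). -/
def traceIdealRight : Submodule Aᵐᵒᵖ A :=
  Submodule.span Aᵐᵒᵖ {a : A | ∃ (m : M) (n : N), a = P.eta m n}

theorem aux_split {R I K T : Type*} [Ring R] [AddCommGroup I] [AddCommGroup K] [AddCommGroup T]
    [Module R I] [Module R K] (q : T →+ I) (hq : Function.Surjective q) (D : T →+ K)
    (act : R → T → T) (hqa : ∀ r t, q (act r t) = r • q t) (hDa : ∀ r t, D (act r t) = r • D t)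
    (hker : ∀ t, q t = 0 → D t = 0) (p : K →ₗ[R] I) (hp : ∀ t, p (D t) = q t)
    [Module.Finite R K] [Module.Projective R K] : Module.Finite R I ∧ Module.Projective R I := by
  have hwd : ∀ t t', q t = q t' → D t = D t' := by
    intro t t' h
    rw [← sub_eq_zero, ← map_sub]
    exact hker _ (by rw [map_sub, h, sub_self])
  choose u hu using hq
  let s : I →ₗ[R] K :=
    { toFun := fun x => D (u x)
      map_add' := fun x y => by
        rw [← map_add]; exact hwd _ _ (by simp [hu])
      map_smul' := fun r x => by
        rw [RingHom.id_apply, ← hDa]; exact hwd _ _ (by simp [hu, hqa]) }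
  have hps : p ∘ₗ s = LinearMap.id := by
    ext x; simp [s, hp, hu]
  exact ⟨Module.Finite.of_surjective p (fun x => ⟨s x, LinearMap.congr_fun hps x⟩),
    Module.Projective.of_split s p hps⟩

theorem aux_pi {k : ℕ} {R M : Type*} [Ring R] [AddCommGroup M] [Module R M]
    [Module.Projective R M] : Module.Projective R (Fin k → M) :=
  Module.Projective.of_equiv (DFinsupp.linearEquivFunOnFintype (R := R) (ι := Fin k) (M := fun _ => M))

theorem aux_regular {B : Type*} [Ring B] [IsSemisimpleRing B] (b : B) : ∃ x, b * x * b = b := by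
  obtain ⟨e, he, h⟩ := IsSemisimpleRing.ideal_eq_span_idempotent (Ideal.span {b})
  have h1 : b ∈ Ideal.span {e} := h ▸ Ideal.mem_span_singleton_self b
  have h2 : e ∈ Ideal.span {b} := h ▸ Ideal.mem_span_singleton_self e
  obtain ⟨y, hy⟩ := Ideal.mem_span_singleton'.1 h1
  obtain ⟨x, hx⟩ := Ideal.mem_span_singleton'.1 h2
  refine ⟨x, ?_⟩
  rw [mul_assoc, hx, ← hy, mul_assoc, he.eq]

theorem aux_central {B : Type*} [Ring B] [IsSemisimpleRing B] (J : Ideal B)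
    (hJ : ∀ x ∈ J, ∀ y, x * y ∈ J) :
    ∃ c ∈ J, (∀ x ∈ J, x * c = x) ∧ ∀ x, c * x = x * c := by
  obtain ⟨e, he, h⟩ := IsSemisimpleRing.ideal_eq_span_idempotent J
  have heJ : e ∈ J := h ▸ Ideal.mem_span_singleton_self e
  have hr : ∀ x ∈ J, x * e = x := by
    intro x hx
    rw [h] at hx
    obtain ⟨y, hy⟩ := Ideal.mem_span_singleton'.1 hx
    rw [← hy, mul_assoc, he.eq]
  refine ⟨e, heJ, hr, fun x => ?_⟩
  have h1 : e * x * e = e * x := hr _ (hJ _ heJ x)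
  obtain ⟨y, hy⟩ := aux_regular ((1 - e) * x * e)
  have h2 : e * y * e = e * y := hr _ (hJ _ heJ y)
  have h3 : (1 - e) * x * e = 0 := by
    rw [← hy]
    have : (1 - e) * x * e * y * ((1 - e) * x * e)
        = (1 - e) * x * (e * y - e * y * e) * (x * e) := by noncomm_ring
    rw [this, h2]; simp
  rw [sub_mul, sub_mul, one_mul, sub_eq_zero] at h3
  rw [h3, h1]

namespace MoritaPairing

theorem eta_zero_left (n : N) : P.eta 0 n = 0 := by
  simpa using P.eta_add_left 0 0 n
theorem eta_zero_right (m : M) : P.eta m 0 = 0 := by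
  simpa using P.eta_add_right m 0 0
theorem rho_zero_left (m : M) : P.rho 0 m = 0 := by
  simpa using P.rho_add_left 0 0 m
theorem rho_neg_left (n : N) (m : M) : P.rho (-n) m = - P.rho n m := by
  rw [eq_neg_iff_add_eq_zero, ← P.rho_add_left, neg_add_cancel, P.rho_zero_left]

theorem exists_sum (hrho_surj : AddSubgroup.closure {b : B | ∃ (n : N) (m : M), b = P.rho n m} = ⊤)
    (b : B) : ∃ (ι : Type) (_ : Fintype ι) (n : ι → N) (m : ι → M), b = ∑ i, P.rho (n i) (m i) := by
  have hb : b ∈ AddSubgroup.closure {b : B | ∃ (n : N) (m : M), b = P.rho n m} := by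
    rw [hrho_surj]; trivial
  induction hb using AddSubgroup.closure_induction with
  | mem x hx =>
    obtain ⟨n, m, rfl⟩ := hx
    exact ⟨Unit, inferInstance, fun _ => n, fun _ => m, by simp⟩
  | zero => exact ⟨Empty, inferInstance, Empty.elim, Empty.elim, by simp⟩
  | add x y _ _ hx hy =>
    obtain ⟨ι, _, n, m, rfl⟩ := hx
    obtain ⟨κ, _, n', m', rfl⟩ := hy
    exact ⟨ι ⊕ κ, inferInstance, Sum.elim n n', Sum.elim m m', by simp⟩
  | neg x _ hx =>
    obtain ⟨ι, _, n, m, rfl⟩ := hx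
    exact ⟨ι, inferInstance, fun i => - n i, m, by simp [P.rho_neg_left]⟩

/-- `m ↦ η(m, n)` as a left linear map. -/
def etaL (n : N) : M →ₗ[A] A where
  toFun m := P.eta m n
  map_add' m m' := P.eta_add_left m m' n
  map_smul' a m := P.eta_smul_left a m n

/-- `n ↦ η(m, n)` as a right linear map. -/
def etaR (m : M) : N →ₗ[Aᵐᵒᵖ] A where
  toFun n := P.eta m n
  map_add' n n' := P.eta_add_right m n n'
  map_smul' a n := P.eta_smul_right a.unop m n

theorem etaR_apply (m : M) (n : N) : P.etaR m n = P.eta m n := rfl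

theorem finproj_M (hrho_surj : AddSubgroup.closure {b : B | ∃ (n : N) (m : M), b = P.rho n m} = ⊤) :
    Module.Finite A M ∧ Module.Projective A M := by
  obtain ⟨ι, _, n, m, h⟩ := P.exists_sum hrho_surj 1
  let p : (ι → A) →ₗ[A] M := Fintype.linearCombination A m
  let s : M →ₗ[A] (ι → A) := LinearMap.pi fun i => P.etaL (n i)
  have hps : p ∘ₗ s = LinearMap.id := by
    ext x
    have : ∑ i, P.eta x (n i) • m i = x := by
      simp_rw [P.assoc_M]
      rw [← Finset.sum_smul, ← Finset.op_sum, ← h, MulOpposite.op_one, one_smul]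
    simpa [p, s, Fintype.linearCombination_apply, etaL] using this
  exact ⟨Module.Finite.of_surjective p (fun x => ⟨s x, LinearMap.congr_fun hps x⟩),
    Module.Projective.of_split s p hps⟩

theorem finproj_N (hrho_surj : AddSubgroup.closure {b : B | ∃ (n : N) (m : M), b = P.rho n m} = ⊤) :
    Module.Finite Aᵐᵒᵖ N ∧ Module.Projective Aᵐᵒᵖ N := by
  obtain ⟨ι, _, n, m, h⟩ := P.exists_sum hrho_surj 1
  let p : (ι → Aᵐᵒᵖ) →ₗ[Aᵐᵒᵖ] N := Fintype.linearCombination Aᵐᵒᵖ n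
  let o : A →ₗ[Aᵐᵒᵖ] Aᵐᵒᵖ :=
    { toFun := op, map_add' := fun _ _ => rfl, map_smul' := fun _ _ => rfl }
  let s : N →ₗ[Aᵐᵒᵖ] (ι → Aᵐᵒᵖ) := LinearMap.pi fun i => o ∘ₗ P.etaR (m i)
  have hps : p ∘ₗ s = LinearMap.id := by
    ext x
    have : ∑ i, op (P.eta (m i) x) • n i = x := by
      simp_rw [← P.assoc_N]
      rw [← Finset.sum_smul, ← h, one_smul]
    simpa [p, s, o, Fintype.linearCombination_apply, etaR_apply] using this
  exact ⟨Module.Finite.of_surjective p (fun x => ⟨s x, LinearMap.congr_fun hps x⟩),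
    Module.Projective.of_split s p hps⟩

theorem etaLift_tmul (m : M) (n : N) : etaLift P (m ⊗ₜ[ℤ] n) = P.eta m n := rfl

theorem left_finproj [Module.Finite B N] [Module.Projective B N]
    (heta_inj : ∀ x : M ⊗[ℤ] N, etaLift P x = 0 →
      x ∈ balancedRel (B := B) (M := M) (N := N))
    (hrho_surj : AddSubgroup.closure {b : B | ∃ (n : N) (m : M), b = P.rho n m} = ⊤) :
    Module.Finite A (traceIdealLeft P) ∧ Module.Projective A (traceIdealLeft P) := by
  obtain ⟨_, _⟩ := P.finproj_M hrho_surj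
  obtain ⟨k, f, g, -, -, hfg⟩ := Module.Finite.exists_comp_eq_id_of_projective B N
  have hN : ∀ n, ∑ j, g n j • f (Pi.single j 1) = n := by
    intro n
    conv_rhs => rw [← LinearMap.id_apply (R := B) n, ← hfg, LinearMap.comp_apply,
      LinearMap.pi_apply_eq_sum_univ f (g n)]
    congr! 3 with j
    ext i
    simp [Pi.single_apply, eq_comm]
  have hmem : ∀ m n, P.eta m n ∈ traceIdealLeft P := fun m n => Submodule.subset_span ⟨m, n, rfl⟩
  have hact : ∀ (a : A) (t : M ⊗[ℤ] N), etaLift P (a • t) = a * etaLift P t := by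
    intro a t
    induction t with
    | zero => simp
    | add x y hx hy => simp [mul_add, hx, hy]
    | tmul m n => rw [TensorProduct.smul_tmul', etaLift_tmul, etaLift_tmul, P.eta_smul_left]
  have hrange : ∀ t, etaLift P t ∈ traceIdealLeft P := by
    intro t
    induction t with
    | zero => simp
    | add x y hx hy => rw [map_add]; exact add_mem hx hy
    | tmul m n => exact hmem m n
  let q : M ⊗[ℤ] N →+ traceIdealLeft P :=
    AddMonoidHom.mk' (fun t => ⟨etaLift P t, hrange t⟩) (fun x y => by ext; simp)
  have hq : Function.Surjective q := by
    rintro ⟨x, hx⟩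
    suffices ∃ t, etaLift P t = x from this.imp fun t ht => Subtype.ext ht
    unfold traceIdealLeft at hx
    induction hx using Submodule.span_induction with
    | mem x hx => obtain ⟨m, n, rfl⟩ := hx; exact ⟨m ⊗ₜ n, rfl⟩
    | zero => exact ⟨0, map_zero _⟩
    | add x y _ _ hx hy =>
      obtain ⟨t, rfl⟩ := hx
      obtain ⟨t', rfl⟩ := hy
      exact ⟨t + t', map_add _ _ _⟩
    | smul a x _ hx =>
      obtain ⟨t, rfl⟩ := hx
      exact ⟨a • t, hact a t⟩
  let D : M ⊗[ℤ] N →+ (Fin k → M) := TensorProduct.liftAddHom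
    (AddMonoidHom.mk' (fun m => AddMonoidHom.mk' (fun n j => op (g n j) • m)
      (fun n n' => by ext j; simp [add_smul]))
      (fun m m' => by ext n j; simp))
    (fun z m n => by rw [map_zsmul, map_zsmul]; rfl)
  have hD : ∀ m n j, D (m ⊗ₜ n) j = op (g n j) • m := fun m n j => rfl
  have hbal : balancedRel (B := B) (M := M) (N := N) ≤ D.ker := by
    unfold balancedRel
    rw [AddSubgroup.closure_le]
    rintro x ⟨b, m, n, rfl⟩
    rw [SetLike.mem_coe, AddMonoidHom.mem_ker, map_sub, sub_eq_zero]
    ext j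
    rw [hD, hD, smul_smul, map_smul, Pi.smul_apply, smul_eq_mul, op_mul]
  let p : (Fin k → M) →ₗ[A] traceIdealLeft P :=
    LinearMap.codRestrict _ (∑ j, P.etaL (f (Pi.single j 1)) ∘ₗ LinearMap.proj j) (by
      intro v
      rw [LinearMap.sum_apply]
      exact sum_mem fun j _ => hmem _ _)
  have hpv : ∀ v, (p v : A) = ∑ j, P.eta (v j) (f (Pi.single j 1)) := by
    intro v
    simp [p, LinearMap.sum_apply, etaL]
  have := aux_pi (k := k) (R := A) (M := M)
  refine aux_split q hq D (fun a t => a • t) (fun a t => Subtype.ext (hact a t)) ?_ ?_ p ?_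
  · intro a t
    induction t with
    | zero => simp
    | add x y hx hy => rw [smul_add, map_add, map_add, smul_add, hx, hy]
    | tmul m n =>
      ext j
      rw [TensorProduct.smul_tmul', Pi.smul_apply, hD, hD, smul_comm a]
  · intro t ht
    exact hbal (heta_inj t (congrArg Subtype.val ht))
  · intro t
    induction t with
    | zero => simp
    | add x y hx hy => rw [map_add, map_add, map_add, hx, hy]
    | tmul m n =>
      ext
      rw [hpv]
      simp_rw [hD, P.eta_balanced]
      change _ = P.eta m n
      conv_rhs => rw [← hN n]
      exact (map_sum (etaAddHom P m) _ _).symm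

theorem right_finproj [Module.Finite Bᵐᵒᵖ M] [Module.Projective Bᵐᵒᵖ M]
    (heta_inj : ∀ x : M ⊗[ℤ] N, etaLift P x = 0 →
      x ∈ balancedRel (B := B) (M := M) (N := N))
    (hrho_surj : AddSubgroup.closure {b : B | ∃ (n : N) (m : M), b = P.rho n m} = ⊤) :
    Module.Finite Aᵐᵒᵖ (traceIdealRight P) ∧ Module.Projective Aᵐᵒᵖ (traceIdealRight P) := by
  obtain ⟨_, _⟩ := P.finproj_N hrho_surj
  obtain ⟨k, f, g, -, -, hfg⟩ := Module.Finite.exists_comp_eq_id_of_projective Bᵐᵒᵖ M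
  have hM : ∀ m, ∑ j, g m j • f (Pi.single j 1) = m := by
    intro n
    conv_rhs => rw [← LinearMap.id_apply (R := Bᵐᵒᵖ) n, ← hfg, LinearMap.comp_apply,
      LinearMap.pi_apply_eq_sum_univ f (g n)]
    congr! 3 with j
    ext i
    simp [Pi.single_apply, eq_comm]
  have hmem : ∀ m n, P.eta m n ∈ traceIdealRight P := fun m n => Submodule.subset_span ⟨m, n, rfl⟩
  let act : Aᵐᵒᵖ → M ⊗[ℤ] N → M ⊗[ℤ] N := fun a =>
    LinearMap.lTensor M (DistribSMul.toAddMonoidHom N a).toIntLinearMap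
  have hadd : ∀ a x y, act a (x + y) = act a x + act a y := fun a x y => map_add _ _ _
  have hzero : ∀ a, act a 0 = 0 := fun a => map_zero _
  have htm : ∀ a (m : M) (n : N), act a (m ⊗ₜ n) = m ⊗ₜ (a • n) := fun a m n => rfl
  have hact : ∀ (a : Aᵐᵒᵖ) (t : M ⊗[ℤ] N), etaLift P (act a t) = a • etaLift P t := by
    intro a t
    induction t with
    | zero => simp [hzero]
    | add x y hx hy => rw [hadd, map_add, map_add, smul_add, hx, hy]
    | tmul m n => exact (P.etaR m).map_smul a n
  have hrange : ∀ t, etaLift P t ∈ traceIdealRight P := by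
    intro t
    induction t with
    | zero => simp
    | add x y hx hy => rw [map_add]; exact add_mem hx hy
    | tmul m n => exact hmem m n
  let q : M ⊗[ℤ] N →+ traceIdealRight P :=
    AddMonoidHom.mk' (fun t => ⟨etaLift P t, hrange t⟩) (fun x y => by ext; simp)
  have hq : Function.Surjective q := by
    rintro ⟨x, hx⟩
    suffices ∃ t, etaLift P t = x from this.imp fun t ht => Subtype.ext ht
    unfold traceIdealRight at hx
    induction hx using Submodule.span_induction with
    | mem x hx => obtain ⟨m, n, rfl⟩ := hx; exact ⟨m ⊗ₜ n, rfl⟩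
    | zero => exact ⟨0, map_zero _⟩
    | add x y _ _ hx hy =>
      obtain ⟨t, rfl⟩ := hx
      obtain ⟨t', rfl⟩ := hy
      exact ⟨t + t', map_add _ _ _⟩
    | smul a x _ hx =>
      obtain ⟨t, rfl⟩ := hx
      exact ⟨act a t, hact a t⟩
  let D : M ⊗[ℤ] N →+ (Fin k → N) := TensorProduct.liftAddHom
    (AddMonoidHom.mk' (fun m => AddMonoidHom.mk' (fun n j => (g m j).unop • n)
      (fun n n' => by ext j; simp))
      (fun m m' => by ext n j; simp [add_smul]))
    (fun z m n => by rw [map_zsmul, map_zsmul]; rfl)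
  have hD : ∀ m n j, D (m ⊗ₜ n) j = (g m j).unop • n := fun m n j => rfl
  have hbal : balancedRel (B := B) (M := M) (N := N) ≤ D.ker := by
    unfold balancedRel
    rw [AddSubgroup.closure_le]
    rintro x ⟨b, m, n, rfl⟩
    rw [SetLike.mem_coe, AddMonoidHom.mem_ker, map_sub, sub_eq_zero]
    ext j
    rw [hD, hD, smul_smul, map_smul, Pi.smul_apply, smul_eq_mul, unop_mul, unop_op]
  let p : (Fin k → N) →ₗ[Aᵐᵒᵖ] traceIdealRight P :=
    LinearMap.codRestrict _ (∑ j, P.etaR (f (Pi.single j 1)) ∘ₗ LinearMap.proj j) (by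
      intro v
      rw [LinearMap.sum_apply]
      exact sum_mem fun j _ => hmem _ _)
  have hpv : ∀ v, (p v : A) = ∑ j, P.eta (f (Pi.single j 1)) (v j) := by
    intro v
    simp [p, LinearMap.sum_apply, etaR_apply]
  have := aux_pi (k := k) (R := Aᵐᵒᵖ) (M := N)
  refine aux_split q hq D act (fun a t => Subtype.ext (hact a t)) ?_ ?_ p ?_
  · intro a t
    induction t with
    | zero => simp [hzero]
    | add x y hx hy => rw [hadd, map_add, map_add, smul_add, hx, hy]
    | tmul m n =>
      ext j
      rw [htm, Pi.smul_apply, hD, hD, smul_comm]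
  · intro t ht
    exact hbal (heta_inj t (congrArg Subtype.val ht))
  · intro t
    induction t with
    | zero => simp
    | add x y hx hy => rw [map_add, map_add, map_add, hx, hy]
    | tmul m n =>
      ext
      rw [hpv]
      simp_rw [hD, ← P.eta_balanced, op_unop]
      change _ = P.eta m n
      conv_rhs => rw [← hM m]
      exact (map_sum (P.etaL n).toAddMonoidHom _ _).symm

theorem exists_full [IsSemisimpleRing B]
    (hrho_surj : AddSubgroup.closure {b : B | ∃ (n : N) (m : M), b = P.rho n m} = ⊤) :
    ∃ (n : N) (m : M), op (P.rho n m) • m = m ∧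
      (1 : B) ∈ Ideal.span {y : B | ∃ z, y = P.rho n m * z} := by
  let S : Set (Ideal B) := {J | ∃ (n : N) (m : M), P.rho n m • n = n ∧ op (P.rho n m) • m = m ∧
    J = Ideal.span {y : B | ∃ z, y = P.rho n m * z}}
  have hS : S.Nonempty := ⟨_, 0, 0, by simp, by simp, rfl⟩
  obtain ⟨J, ⟨n, m, hn, hm, hJ⟩, hmax⟩ :=
    set_has_maximal_iff_noetherian.2 (inferInstance : IsNoetherian B B) S hS
  refine ⟨n, m, hm, ?_⟩
  have hJ2 : ∀ x ∈ J, ∀ y, x * y ∈ J := by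
    intro x hx y
    rw [hJ] at hx ⊢
    induction hx using Submodule.span_induction with
    | mem x hx =>
      obtain ⟨z, rfl⟩ := hx
      exact Ideal.subset_span ⟨z * y, mul_assoc _ _ _⟩
    | zero => simp
    | add u v _ _ hu hv => rw [add_mul]; exact add_mem hu hv
    | smul a u _ hu => rw [smul_mul_assoc]; exact Submodule.smul_mem _ a hu
  obtain ⟨c, hcJ, hc, hcent⟩ := aux_central J hJ2
  rw [← hJ]
  by_contra h1
  set F := P.rho n m with hF
  have hFJ : F ∈ J := by rw [hJ]; exact Ideal.subset_span ⟨1, (mul_one _).symm⟩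
  have hFc : F * c = F := hc F hFJ
  have hcc : c * c = c := hc c hcJ
  have hcF : c * F = F := by rw [hcent, hFc]
  obtain ⟨n₀, m₀, h0⟩ : ∃ n₀ m₀, (1 - c) * P.rho n₀ m₀ ≠ 0 := by
    by_contra! hcon
    obtain ⟨ι, _, n', m', h⟩ := P.exists_sum hrho_surj 1
    have : (1 - c) * 1 = 0 := by
      nth_rewrite 2 [h]
      rw [Finset.mul_sum]; exact Finset.sum_eq_zero fun i _ => hcon _ _
    rw [mul_one, sub_eq_zero] at this
    exact h1 (this ▸ hcJ)
  set d := 1 - c with hd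
  have hdc : d * c = 0 := by rw [hd, sub_mul, hcc, one_mul, sub_self]
  have hcd : c * d = 0 := by rw [hd, mul_sub, hcc, mul_one, sub_self]
  have hdd : d * d = d := by rw [hd, mul_sub, mul_one, ← hd, hdc, sub_zero]
  have hdcent : ∀ x, d * x = x * d := by
    intro x; rw [hd, sub_mul, mul_sub, hcent, one_mul, mul_one]
  set b := d * P.rho n₀ m₀ with hb
  obtain ⟨x, hx⟩ := aux_regular b
  have hdb : d * b = b := by rw [hb, ← mul_assoc, hdd]
  have hbd : b * d = b := by rw [← hdcent, hdb]
  set G := b * x with hG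
  have hGG : G * G = G := by rw [hG, ← mul_assoc, hx]
  have hdG : d * G = G := by rw [hG, ← mul_assoc, hdb]
  have hGd : G * d = G := by rw [← hdcent, hdG]
  have hG0 : G ≠ 0 := by
    intro h; rw [h, zero_mul] at hx; exact h0 hx.symm
  have hcG : c * G = 0 := by rw [← hdG, ← mul_assoc, hcd, zero_mul]
  have hGc : G * c = 0 := by rw [← hcent, hcG]
  have hFG : F * G = 0 := by rw [← hFc, mul_assoc, hcG, mul_zero]
  have hGF : G * F = 0 := by rw [← hcF, ← mul_assoc, hGc, zero_mul]
  have hrG : P.rho (d • n₀) (op x • m₀) = G := by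
    rw [P.rho_smul_left, P.rho_smul_right, ← mul_assoc]
  -- the orthogonal correction
  let n₁ := G • (d • n₀)
  let m₁ := op G • (op x • m₀)
  have hn₁ : G • n₁ = n₁ := by simp only [n₁]; rw [smul_smul G G, hGG]
  have hm₁ : op G • m₁ = m₁ := by simp only [m₁]; rw [smul_smul (op G) (op G), ← op_mul, hGG]
  have hr1 : P.rho n₁ m₁ = G := by
    simp only [n₁, m₁]
    rw [P.rho_smul_left, P.rho_smul_right, hrG, hGG, hGG]
  have hr2 : P.rho n m₁ = 0 := by
    rw [← hn, ← hm₁, P.rho_smul_left, P.rho_smul_right, ← hcF, hcent, mul_assoc, ← mul_assoc c,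
      hcent, mul_assoc, hcG, mul_zero, mul_zero]
  have hr3 : P.rho n₁ m = 0 := by
    rw [← hm, ← hn₁, P.rho_smul_left, P.rho_smul_right, ← hcF, ← mul_assoc, ← mul_assoc,
      mul_assoc G, ← hcent, ← mul_assoc, hGc, zero_mul, zero_mul]
  have hsum : P.rho (n + n₁) (m + m₁) = F + G := by
    rw [P.rho_add_left, P.rho_add_right, P.rho_add_right, hr1, hr2, hr3, add_zero, zero_add]
  have hFn₁ : F • n₁ = 0 := by rw [← hn₁, smul_smul, hFG, zero_smul]
  have hGn : G • n = 0 := by rw [← hn, smul_smul, hGF, zero_smul]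
  have hFm₁ : op F • m₁ = 0 := by rw [← hm₁, smul_smul, ← op_mul, hGF, op_zero, zero_smul]
  have hGm : op G • m = 0 := by rw [← hm, smul_smul, ← op_mul, hFG, op_zero, zero_smul]
  refine hmax (Ideal.span {y : B | ∃ z, y = (F + G) * z}) ⟨n + n₁, m + m₁, ?_, ?_, by rw [hsum]⟩ ?_
  · rw [hsum, add_smul, smul_add, smul_add, hn, hn₁, hFn₁, hGn, add_zero, zero_add]
  · rw [hsum, op_add, add_smul, smul_add, smul_add, hm, hm₁, hFm₁, hGm, add_zero, zero_add]
  · refine lt_of_le_of_ne ?_ ?_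
    · rw [hJ, Ideal.span_le]
      rintro y ⟨z, rfl⟩
      have h : F * z = F * ((F + G) * z) := by
        have hFF : F * F = F := by
          nth_rewrite 2 [hF]
          rw [← P.rho_smul_left, hn]
        rw [← mul_assoc, mul_add, hFF, hFG, add_zero]
      rw [SetLike.mem_coe, h]
      exact Ideal.mul_mem_left _ _ (Ideal.subset_span ⟨z, rfl⟩)
    · intro h
      have hGJ : G ∈ J := by
        rw [h]
        have : G = G * ((F + G) * 1) := by rw [mul_one, mul_add, hGF, hGG, zero_add]
        have hmem : G * ((F + G) * 1) ∈ Ideal.span {y : B | ∃ z, y = (F + G) * z} :=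
          Ideal.mul_mem_left _ G (Ideal.subset_span ⟨1, rfl⟩)
        rwa [← this] at hmem
      exact hG0 ((hc G hGJ).symm.trans hGc)

theorem exists_idem [IsSemisimpleRing B]
    (hrho_surj : AddSubgroup.closure {b : B | ∃ (n : N) (m : M), b = P.rho n m} = ⊤) :
    ∃ e : A, IsIdempotentElem e ∧
      traceIdealLeft P = Submodule.span A {y : A | ∃ z : A, y = e * z} := by
  obtain ⟨n, m, hm, h1⟩ := P.exists_full hrho_surj
  have hem : P.eta m n • m = m := by rw [P.assoc_M, hm]
  refine ⟨P.eta m n, ?_, le_antisymm ?_ ?_⟩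
  · rw [IsIdempotentElem, ← P.eta_smul_left, hem]
  · have key : ∀ b ∈ Ideal.span {y : B | ∃ z, y = P.rho n m * z}, ∀ m' n',
        P.eta (op b • m') n' ∈ Submodule.span A {y : A | ∃ z : A, y = P.eta m n * z} := by
      intro b hb
      induction hb using Submodule.span_induction with
      | mem x hx =>
        obtain ⟨z, rfl⟩ := hx
        intro m' n'
        rw [op_mul, mul_smul, ← P.assoc_M, P.eta_balanced, P.eta_smul_left, ← smul_eq_mul]
        refine Submodule.smul_mem _ _ (Submodule.subset_span ⟨P.eta m (z • n'), ?_⟩)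
        rw [← P.eta_smul_left, hem]
      | zero => intro m' n'; simp [P.eta_zero_left]
      | add x y _ _ hx hy =>
        intro m' n'
        rw [op_add, add_smul, P.eta_add_left]
        exact add_mem (hx _ _) (hy _ _)
      | smul a x _ hx =>
        intro m' n'
        rw [smul_eq_mul, op_mul, mul_smul]
        exact hx _ _
    unfold traceIdealLeft
    rw [Submodule.span_le]
    rintro y ⟨m', n', rfl⟩
    simpa using key 1 h1 m' n'
  · rw [Submodule.span_le]
    rintro y ⟨z, rfl⟩
    rw [← P.eta_smul_right]
    exact Submodule.subset_span ⟨_, _, rfl⟩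

end MoritaPairing

/-- Let `(M, N, η, ρ)` be a Morita context between rings `A` and `B`
with `B` semisimple, `M` finitely generated projective as a right `B`-module, `N`
finitely generated projective as a left `B`-module, and `η` injective.  If `ρ` is
surjective, then the trace ideal `I = im η ⊆ A` is generated as a two-sided ideal by an
idempotent `e` (`I = AeA`), and `I` is finitely generated projective both as a left and
as a right `A`-module. -/
theorem trace_ideal_generated_by_idempotent
    [IsSemisimpleRing B]
    [Module.Finite Bᵐᵒᵖ M] [Module.Projective Bᵐᵒᵖ M]
    [Module.Finite B N] [Module.Projective B N]
    (heta_inj : ∀ x : M ⊗[ℤ] N, etaLift P x = 0 →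
      x ∈ balancedRel (B := B) (M := M) (N := N))
    (hrho_surj : AddSubgroup.closure {b : B | ∃ (n : N) (m : M), b = P.rho n m} = ⊤) :
    ∃ e : A, IsIdempotentElem e ∧
      traceIdealLeft P = Submodule.span A {y : A | ∃ z : A, y = e * z} ∧
      Module.Finite A (traceIdealLeft P) ∧ Module.Projective A (traceIdealLeft P) ∧
      Module.Finite Aᵐᵒᵖ (traceIdealRight P) ∧
      Module.Projective Aᵐᵒᵖ (traceIdealRight P) := by
  obtain ⟨e, he, hI⟩ := P.exists_idem hrho_surj
  obtain ⟨h1, h2⟩ := P.left_finproj heta_inj hrho_surj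
  obtain ⟨h3, h4⟩ := P.right_finproj heta_inj hrho_surj
  exact ⟨e, he, hI, h1, h2, h3, h4⟩

end MoritaSetup
end

section
/- Let k be a commutative ring, a, q ∈ k, and n a natural number. Then the k-linear maps C_n(a) ⊗_k H_n(q) → H^c_n(a;q), x ⊗ y ↦ ι_C(x)·ι_H(y), and H_n(q) ⊗_k C_n(a) → H^c_n(a;q), y ⊗ x ↦ ι_H(y)·ι_C(x), induced by multiplication via the canonical algebra homomorphisms ι_C : C_n(a) → H^c_n(a;q) and ι_H : H_n(q) → H^c_n(a;q), are both isomorphisms of k-modules. -/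
open scoped TensorProduct

universe u

variable (k : Type u) [CommRing k]

/-- The defining relations of the Clifford algebra `C_n(a)`:
`c_i² = a` and `c_i c_j = -c_j c_i` for `i ≠ j`. -/
inductive CliffordRel (a : k) (n : ℕ) :
    FreeAlgebra k (Fin n) → FreeAlgebra k (Fin n) → Prop
  | sq (i : Fin n) :
      CliffordRel a n (FreeAlgebra.ι k i * FreeAlgebra.ι k i)
        (algebraMap k (FreeAlgebra k (Fin n)) a)
  | anticomm (i j : Fin n) (h : i ≠ j) :
      CliffordRel a n (FreeAlgebra.ι k i * FreeAlgebra.ι k j)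
        (-(FreeAlgebra.ι k j * FreeAlgebra.ι k i))

/-- The Clifford algebra `C_n(a)` over `k`. -/
abbrev CliffordAlg (a : k) (n : ℕ) : Type u := RingQuot (CliffordRel k a n)

/-- The defining relations of the Iwahori–Hecke algebra `H_n(q)` of type `A_{n-1}`:
`T_i T_j = T_j T_i` for `|i - j| ≥ 2`, `T_i T_{i+1} T_i = T_{i+1} T_i T_{i+1}`, and
`(T_i - q)(T_i + 1) = 0`. -/
inductive HeckeRel (q : k) (n : ℕ) :
    FreeAlgebra k (Fin (n - 1)) → FreeAlgebra k (Fin (n - 1)) → Prop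
  | comm (i j : Fin (n - 1)) (h : (i : ℕ) + 2 ≤ (j : ℕ) ∨ (j : ℕ) + 2 ≤ (i : ℕ)) :
      HeckeRel q n (FreeAlgebra.ι k i * FreeAlgebra.ι k j)
        (FreeAlgebra.ι k j * FreeAlgebra.ι k i)
  | braid (i j : Fin (n - 1)) (h : (j : ℕ) = (i : ℕ) + 1) :
      HeckeRel q n (FreeAlgebra.ι k i * FreeAlgebra.ι k j * FreeAlgebra.ι k i)
        (FreeAlgebra.ι k j * FreeAlgebra.ι k i * FreeAlgebra.ι k j)
  | quad (i : Fin (n - 1)) :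
      HeckeRel q n
        ((FreeAlgebra.ι k i - algebraMap k (FreeAlgebra k (Fin (n - 1))) q) *
          (FreeAlgebra.ι k i + 1)) 0

/-- The Iwahori–Hecke algebra `H_n(q)` of type `A_{n-1}` over `k`. -/
abbrev HeckeAlg (q : k) (n : ℕ) : Type u := RingQuot (HeckeRel k q n)

/-- The index `i` of `c_i`, as an element of `Fin n` (for `i : Fin (n-1)`). -/
def cIdx {n : ℕ} (i : Fin (n - 1)) : Fin n :=
  ⟨(i : ℕ), lt_of_lt_of_le i.isLt (Nat.sub_le n 1)⟩

/-- The index `i+1` of `c_{i+1}`, as an element of `Fin n` (for `i : Fin (n-1)`). -/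
def cIdxSucc {n : ℕ} (i : Fin (n - 1)) : Fin n :=
  ⟨(i : ℕ) + 1, by omega⟩

/-- In the free algebra on `c_1, …, c_n, T_1, …, T_{n-1}`, the generator `c_i`. -/
def fC (n : ℕ) (i : Fin n) : FreeAlgebra k (Fin n ⊕ Fin (n - 1)) :=
  FreeAlgebra.ι k (Sum.inl i)

/-- In the free algebra on `c_1, …, c_n, T_1, …, T_{n-1}`, the generator `T_i`. -/
def fT (n : ℕ) (i : Fin (n - 1)) : FreeAlgebra k (Fin n ⊕ Fin (n - 1)) :=
  FreeAlgebra.ι k (Sum.inr i)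

/-- The defining relations of the Hecke–Clifford algebra `H^c_n(a; q)`: the Clifford
relations among the `c_i`, the Hecke relations among the `T_i`, together with the mixed
relations `T_i c_j = c_j T_i` for `j ≠ i, i+1`, `T_i c_i = c_{i+1} T_i`, and
`(T_i - q + 1) c_{i+1} = c_i (T_i - q + 1)`. -/
inductive HeckeCliffordRel (a q : k) (n : ℕ) :
    FreeAlgebra k (Fin n ⊕ Fin (n - 1)) → FreeAlgebra k (Fin n ⊕ Fin (n - 1)) → Prop
  | c_sq (i : Fin n) :
      HeckeCliffordRel a q n (fC k n i * fC k n i)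
        (algebraMap k (FreeAlgebra k (Fin n ⊕ Fin (n - 1))) a)
  | c_anticomm (i j : Fin n) (h : i ≠ j) :
      HeckeCliffordRel a q n (fC k n i * fC k n j) (-(fC k n j * fC k n i))
  | t_comm (i j : Fin (n - 1)) (h : (i : ℕ) + 2 ≤ (j : ℕ) ∨ (j : ℕ) + 2 ≤ (i : ℕ)) :
      HeckeCliffordRel a q n (fT k n i * fT k n j) (fT k n j * fT k n i)
  | t_braid (i j : Fin (n - 1)) (h : (j : ℕ) = (i : ℕ) + 1) :
      HeckeCliffordRel a q n (fT k n i * fT k n j * fT k n i)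
        (fT k n j * fT k n i * fT k n j)
  | t_quad (i : Fin (n - 1)) :
      HeckeCliffordRel a q n
        ((fT k n i - algebraMap k (FreeAlgebra k (Fin n ⊕ Fin (n - 1))) q) *
          (fT k n i + 1)) 0
  | tc_comm (i : Fin (n - 1)) (j : Fin n)
      (h : (j : ℕ) ≠ (i : ℕ) ∧ (j : ℕ) ≠ (i : ℕ) + 1) :
      HeckeCliffordRel a q n (fT k n i * fC k n j) (fC k n j * fT k n i)
  | tc_shift (i : Fin (n - 1)) :
      HeckeCliffordRel a q n (fT k n i * fC k n (cIdx i)) (fC k n (cIdxSucc i) * fT k n i)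
  | tc_mixed (i : Fin (n - 1)) :
      HeckeCliffordRel a q n
        ((fT k n i - algebraMap k (FreeAlgebra k (Fin n ⊕ Fin (n - 1))) q + 1) *
          fC k n (cIdxSucc i))
        (fC k n (cIdx i) *
          (fT k n i - algebraMap k (FreeAlgebra k (Fin n ⊕ Fin (n - 1))) q + 1))

/-- The Hecke–Clifford algebra `H^c_n(a; q)` over `k`. -/
abbrev HeckeCliffordAlg (a q : k) (n : ℕ) : Type u := RingQuot (HeckeCliffordRel k a q n)

/-- The generator `c_i` of the Clifford algebra `C_n(a)`. -/
def cGen (a : k) (n : ℕ) (i : Fin n) : CliffordAlg k a n :=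
  RingQuot.mkAlgHom k (CliffordRel k a n) (FreeAlgebra.ι k i)

/-- The generator `T_i` of the Iwahori–Hecke algebra `H_n(q)`. -/
def tGen (q : k) (n : ℕ) (i : Fin (n - 1)) : HeckeAlg k q n :=
  RingQuot.mkAlgHom k (HeckeRel k q n) (FreeAlgebra.ι k i)

/-- The generator `c_i` of the Hecke–Clifford algebra `H^c_n(a; q)`. -/
def hcCGen (a q : k) (n : ℕ) (i : Fin n) : HeckeCliffordAlg k a q n :=
  RingQuot.mkAlgHom k (HeckeCliffordRel k a q n) (fC k n i)

/-- The generator `T_i` of the Hecke–Clifford algebra `H^c_n(a; q)`. -/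
def hcTGen (a q : k) (n : ℕ) (i : Fin (n - 1)) : HeckeCliffordAlg k a q n :=
  RingQuot.mkAlgHom k (HeckeCliffordRel k a q n) (fT k n i)

set_option linter.unusedSimpArgs false

namespace HCProof

variable {k : Type u} [CommRing k]

/-! Induction principle for algebras generated by a set. -/

theorem gen_stable {X A : Type*} [Ring A] [Algebra k A] (f : FreeAlgebra k X →ₐ[k] A)
    (N : Submodule k A) (h : ∀ x, ∀ m ∈ N, f (FreeAlgebra.ι k x) * m ∈ N)
    (z : FreeAlgebra k X) : ∀ m ∈ N, f z * m ∈ N := by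
  induction z using FreeAlgebra.induction with
  | grade0 r =>
    intro m hm
    rw [AlgHom.commutes, ← Algebra.smul_def]
    exact N.smul_mem _ hm
  | grade1 x => exact h x
  | mul a b ha hb =>
    intro m hm
    rw [map_mul, mul_assoc]
    exact ha _ (hb _ hm)
  | add a b ha hb =>
    intro m hm
    rw [map_add, add_mul]
    exact N.add_mem (ha _ hm) (hb _ hm)

theorem gen_top {X A : Type*} [Ring A] [Algebra k A] (f : FreeAlgebra k X →ₐ[k] A)
    (hf : Function.Surjective f)
    (N : Submodule k A) (h1 : (1 : A) ∈ N)
    (h : ∀ x, ∀ m ∈ N, f (FreeAlgebra.ι k x) * m ∈ N) (z : A) : z ∈ N := by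
  obtain ⟨w, rfl⟩ := hf z
  simpa using gen_stable f N h w 1 h1

theorem c_top (a : k) (n : ℕ) (N : Submodule k (CliffordAlg k a n)) (h1 : 1 ∈ N)
    (h : ∀ j, ∀ m ∈ N, cGen k a n j * m ∈ N) (z : CliffordAlg k a n) : z ∈ N :=
  gen_top _ (RingQuot.mkAlgHom_surjective k _) N h1 h z

theorem h_top (q : k) (n : ℕ) (N : Submodule k (HeckeAlg k q n)) (h1 : 1 ∈ N)
    (h : ∀ j, ∀ m ∈ N, tGen k q n j * m ∈ N) (z : HeckeAlg k q n) : z ∈ N :=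
  gen_top _ (RingQuot.mkAlgHom_surjective k _) N h1 h z

theorem hc_top (a q : k) (n : ℕ) (N : Submodule k (HeckeCliffordAlg k a q n)) (h1 : 1 ∈ N)
    (h : ∀ j, ∀ m ∈ N, hcCGen k a q n j * m ∈ N)
    (h' : ∀ j, ∀ m ∈ N, hcTGen k a q n j * m ∈ N) (z : HeckeCliffordAlg k a q n) : z ∈ N :=
  gen_top _ (RingQuot.mkAlgHom_surjective k _) N h1
    (fun x => match x with | Sum.inl j => h j | Sum.inr j => h' j) z

/-! Relations in the algebras. -/

theorem c_sq (a : k) (n : ℕ) (i : Fin n) :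
    cGen k a n i * cGen k a n i = algebraMap k _ a := by
  have := RingQuot.mkAlgHom_rel k (CliffordRel.sq (k := k) (a := a) i)
  simpa [cGen] using this

theorem c_anti (a : k) (n : ℕ) (i j : Fin n) (h : i ≠ j) :
    cGen k a n i * cGen k a n j = -(cGen k a n j * cGen k a n i) := by
  have := RingQuot.mkAlgHom_rel k (CliffordRel.anticomm (k := k) (a := a) i j h)
  simpa [cGen] using this

theorem t_comm (q : k) (n : ℕ) (i j : Fin (n - 1))
    (h : (i : ℕ) + 2 ≤ (j : ℕ) ∨ (j : ℕ) + 2 ≤ (i : ℕ)) :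
    tGen k q n i * tGen k q n j = tGen k q n j * tGen k q n i := by
  have := RingQuot.mkAlgHom_rel k (HeckeRel.comm (k := k) (q := q) i j h)
  simpa [tGen] using this

theorem t_braid (q : k) (n : ℕ) (i j : Fin (n - 1)) (h : (j : ℕ) = (i : ℕ) + 1) :
    tGen k q n i * tGen k q n j * tGen k q n i = tGen k q n j * tGen k q n i * tGen k q n j := by
  have := RingQuot.mkAlgHom_rel k (HeckeRel.braid (k := k) (q := q) i j h)
  simpa [tGen] using this

/-- Reformulation of the quadratic relation. -/
theorem quad_iff {A : Type*} [Ring A] [Algebra k A] (q : k) (T : A) :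
    (T - algebraMap k A q) * (T + 1) = 0 ↔ T * T = (q - 1) • T + q • (1 : A) := by
  rw [← sub_eq_zero (a := T * T)]
  have : (T - algebraMap k A q) * (T + 1) = T * T - ((q - 1) • T + q • (1 : A)) := by
    rw [Algebra.algebraMap_eq_smul_one, sub_mul, mul_add, smul_mul_assoc, mul_one, one_mul]
    try module
  rw [this]

/-- Reformulation of the mixed relation. -/
theorem mixed_iff {A : Type*} [Ring A] [Algebra k A] (q : k) (T c d : A) :
    (T - algebraMap k A q + 1) * d = c * (T - algebraMap k A q + 1) ↔
      T * d = c * T + (q - 1) • (d - c) := by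
  rw [← sub_eq_zero, ← sub_eq_zero (a := T * d)]
  have : (T - algebraMap k A q + 1) * d - c * (T - algebraMap k A q + 1)
      = T * d - (c * T + (q - 1) • (d - c)) := by
    simp only [Algebra.algebraMap_eq_smul_one, sub_mul, mul_add, mul_sub, add_mul,
      smul_mul_assoc, mul_smul_comm, mul_one, one_mul]
    try module
  rw [this]

theorem t_quad (q : k) (n : ℕ) (i : Fin (n - 1)) :
    tGen k q n i * tGen k q n i = (q - 1) • tGen k q n i + q • 1 := by
  have := RingQuot.mkAlgHom_rel k (HeckeRel.quad (k := k) (q := q) i)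
  rw [map_mul, map_sub, map_add, AlgHom.commutes, map_zero, map_one] at this
  exact (quad_iff q _).1 this

section HC
variable (a q : k) (n : ℕ)

theorem hc_sq (i : Fin n) :
    hcCGen k a q n i * hcCGen k a q n i = algebraMap k _ a := by
  have := RingQuot.mkAlgHom_rel k (HeckeCliffordRel.c_sq (k := k) (a := a) (q := q) i)
  rw [map_mul, AlgHom.commutes] at this
  exact this

theorem hc_anti (i j : Fin n) (h : i ≠ j) :
    hcCGen k a q n i * hcCGen k a q n j = -(hcCGen k a q n j * hcCGen k a q n i) := by
  have := RingQuot.mkAlgHom_rel k (HeckeCliffordRel.c_anticomm (k := k) (a := a) (q := q) i j h)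
  rw [map_mul, map_neg, map_mul] at this
  exact this

theorem hc_tcomm (i j : Fin (n - 1))
    (h : (i : ℕ) + 2 ≤ (j : ℕ) ∨ (j : ℕ) + 2 ≤ (i : ℕ)) :
    hcTGen k a q n i * hcTGen k a q n j = hcTGen k a q n j * hcTGen k a q n i := by
  have := RingQuot.mkAlgHom_rel k (HeckeCliffordRel.t_comm (k := k) (a := a) (q := q) i j h)
  rw [map_mul, map_mul] at this
  exact this

theorem hc_tbraid (i j : Fin (n - 1)) (h : (j : ℕ) = (i : ℕ) + 1) :
    hcTGen k a q n i * hcTGen k a q n j * hcTGen k a q n i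
      = hcTGen k a q n j * hcTGen k a q n i * hcTGen k a q n j := by
  have := RingQuot.mkAlgHom_rel k (HeckeCliffordRel.t_braid (k := k) (a := a) (q := q) i j h)
  simp only [map_mul] at this
  exact this

theorem hc_tquad (i : Fin (n - 1)) :
    hcTGen k a q n i * hcTGen k a q n i = (q - 1) • hcTGen k a q n i + q • 1 := by
  have := RingQuot.mkAlgHom_rel k (HeckeCliffordRel.t_quad (k := k) (a := a) (q := q) i)
  rw [map_mul, map_sub, map_add, AlgHom.commutes, map_zero, map_one] at this
  exact (quad_iff q _).1 this

theorem hc_tc_comm (i : Fin (n - 1)) (j : Fin n)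
    (h : (j : ℕ) ≠ (i : ℕ) ∧ (j : ℕ) ≠ (i : ℕ) + 1) :
    hcTGen k a q n i * hcCGen k a q n j = hcCGen k a q n j * hcTGen k a q n i := by
  have := RingQuot.mkAlgHom_rel k (HeckeCliffordRel.tc_comm (k := k) (a := a) (q := q) i j h)
  rw [map_mul, map_mul] at this
  exact this

theorem hc_tc_shift (i : Fin (n - 1)) :
    hcTGen k a q n i * hcCGen k a q n (cIdx i)
      = hcCGen k a q n (cIdxSucc i) * hcTGen k a q n i := by
  have := RingQuot.mkAlgHom_rel k (HeckeCliffordRel.tc_shift (k := k) (a := a) (q := q) i)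
  rw [map_mul, map_mul] at this
  exact this

theorem hc_tc_mixed (i : Fin (n - 1)) :
    hcTGen k a q n i * hcCGen k a q n (cIdxSucc i)
      = hcCGen k a q n (cIdx i) * hcTGen k a q n i
        + (q - 1) • (hcCGen k a q n (cIdxSucc i) - hcCGen k a q n (cIdx i)) := by
  have := RingQuot.mkAlgHom_rel k (HeckeCliffordRel.tc_mixed (k := k) (a := a) (q := q) i)
  rw [map_mul, map_mul, map_add, map_sub, AlgHom.commutes, map_one] at this
  exact (mixed_iff q _ _ _).1 this

end HC

/-! Universal properties. -/

section lifts
variable {A : Type*} [Ring A] [Algebra k A] (a q : k) (n : ℕ)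

theorem exists_cLift (f : Fin n → A) (h1 : ∀ i, f i * f i = algebraMap k A a)
    (h2 : ∀ i j, i ≠ j → f i * f j = -(f j * f i)) :
    ∃ F : CliffordAlg k a n →ₐ[k] A, ∀ i, F (cGen k a n i) = f i := by
  refine ⟨RingQuot.liftAlgHom k ⟨FreeAlgebra.lift k f, ?_⟩, fun i => ?_⟩
  · intro x y h
    induction h with
    | sq i => simpa using h1 i
    | anticomm i j h => simpa using h2 i j h
  · simp [cGen]

theorem exists_tLift (f : Fin (n - 1) → A)
    (h1 : ∀ i j : Fin (n - 1), ((i : ℕ) + 2 ≤ (j : ℕ) ∨ (j : ℕ) + 2 ≤ (i : ℕ)) →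
      f i * f j = f j * f i)
    (h2 : ∀ i j : Fin (n - 1), (j : ℕ) = (i : ℕ) + 1 → f i * f j * f i = f j * f i * f j)
    (h3 : ∀ i, f i * f i = (q - 1) • f i + q • (1 : A)) :
    ∃ F : HeckeAlg k q n →ₐ[k] A, ∀ i, F (tGen k q n i) = f i := by
  refine ⟨RingQuot.liftAlgHom k ⟨FreeAlgebra.lift k f, ?_⟩, fun i => ?_⟩
  · intro x y h
    induction h with
    | comm i j h => simpa using h1 i j h
    | braid i j h => simpa using h2 i j h
    | quad i => simpa using (quad_iff q (f i)).2 (h3 i)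
  · simp [tGen]

theorem exists_hcLift (c : Fin n → A) (f : Fin (n - 1) → A)
    (hc1 : ∀ i, c i * c i = algebraMap k A a)
    (hc2 : ∀ i j, i ≠ j → c i * c j = -(c j * c i))
    (h1 : ∀ i j : Fin (n - 1), ((i : ℕ) + 2 ≤ (j : ℕ) ∨ (j : ℕ) + 2 ≤ (i : ℕ)) →
      f i * f j = f j * f i)
    (h2 : ∀ i j : Fin (n - 1), (j : ℕ) = (i : ℕ) + 1 → f i * f j * f i = f j * f i * f j)
    (h3 : ∀ i, f i * f i = (q - 1) • f i + q • (1 : A))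
    (m1 : ∀ (i : Fin (n - 1)) (j : Fin n), ((j : ℕ) ≠ (i : ℕ) ∧ (j : ℕ) ≠ (i : ℕ) + 1) →
      f i * c j = c j * f i)
    (m2 : ∀ i : Fin (n - 1), f i * c (cIdx i) = c (cIdxSucc i) * f i)
    (m3 : ∀ i : Fin (n - 1), f i * c (cIdxSucc i) = c (cIdx i) * f i
      + (q - 1) • (c (cIdxSucc i) - c (cIdx i))) :
    ∃ F : HeckeCliffordAlg k a q n →ₐ[k] A, (∀ i, F (hcCGen k a q n i) = c i) ∧
      ∀ i, F (hcTGen k a q n i) = f i := by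
  refine ⟨RingQuot.liftAlgHom k ⟨FreeAlgebra.lift k (Sum.elim c f), ?_⟩,
    fun i => ?_, fun i => ?_⟩
  · intro x y h
    induction h with
    | c_sq i => simpa [fC] using hc1 i
    | c_anticomm i j h => simpa [fC] using hc2 i j h
    | t_comm i j h => simpa [fT] using h1 i j h
    | t_braid i j h => simpa [fT] using h2 i j h
    | t_quad i => simpa [fT] using (quad_iff q (f i)).2 (h3 i)
    | tc_comm i j h => simpa [fT, fC] using m1 i j h
    | tc_shift i => simpa [fT, fC] using m2 i
    | tc_mixed i => simpa [fT, fC] using (mixed_iff q _ _ _).2 (m3 i)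
  · simp [hcCGen, fC]
  · simp [hcTGen, fT]

end lifts

/-! The twisted derivations on the Clifford algebra. -/

theorem idx_cases {n : ℕ} (i : Fin (n - 1)) (j : Fin n) :
    j = cIdx i ∨ j = cIdxSucc i ∨ ((j : ℕ) ≠ (i : ℕ) ∧ (j : ℕ) ≠ (i : ℕ) + 1) := by
  simp only [cIdx, cIdxSucc, Fin.ext_iff]
  omega

theorem idx_ne {n : ℕ} (i : Fin (n - 1)) : cIdx i ≠ cIdxSucc i := by
  simp [cIdx, cIdxSucc, Fin.ext_iff]

theorem idx_ne1 {n : ℕ} (i : Fin (n - 1)) (j : Fin n)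
    (h : (j : ℕ) ≠ (i : ℕ) ∧ (j : ℕ) ≠ (i : ℕ) + 1) : j ≠ cIdx i := by
  simp [cIdx, Fin.ext_iff]; omega

theorem idx_ne2 {n : ℕ} (i : Fin (n - 1)) (j : Fin n)
    (h : (j : ℕ) ≠ (i : ℕ) ∧ (j : ℕ) ≠ (i : ℕ) + 1) : j ≠ cIdxSucc i := by
  simp [cIdxSucc, Fin.ext_iff]; omega

/-- The images of the generators under the twisted derivation. -/
noncomputable def dGen (a : k) (n : ℕ) (i : Fin (n - 1)) (j : Fin n) : CliffordAlg k a n :=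
  if j = cIdxSucc i then cGen k a n (cIdxSucc i) - cGen k a n (cIdx i) else 0

theorem exists_twist (a : k) (n : ℕ) (i : Fin (n - 1)) :
    ∃ F : CliffordAlg k a n →ₐ[k] Matrix (Fin 2) (Fin 2) (CliffordAlg k a n),
      ∀ j, F (cGen k a n j) =
        !![cGen k a n (Equiv.swap (cIdx i) (cIdxSucc i) j), dGen a n i j; 0, cGen k a n j] := by
  apply exists_cLift
  · intro j
    ext x y
    rcases idx_cases i j with rfl | rfl | h
    · fin_cases x <;> fin_cases y <;>
        simp [Matrix.mul_apply, Matrix.algebraMap_matrix_apply, c_sq, dGen, idx_ne]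
    · fin_cases x <;> fin_cases y <;>
        simp [Matrix.mul_apply, Matrix.algebraMap_matrix_apply, c_sq, dGen, mul_sub, sub_mul]
    · fin_cases x <;> fin_cases y <;>
        simp [Matrix.mul_apply, Matrix.algebraMap_matrix_apply, c_sq, dGen, idx_ne2 i j h]
  · intro j l hjl
    have e : ∀ j l, j ≠ l → cGen k a n (Equiv.swap (cIdx i) (cIdxSucc i) j) *
        cGen k a n (Equiv.swap (cIdx i) (cIdxSucc i) l) =
        -(cGen k a n (Equiv.swap (cIdx i) (cIdxSucc i) l) *
          cGen k a n (Equiv.swap (cIdx i) (cIdxSucc i) j)) := fun j l h =>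
      c_anti a n _ _ (fun h' => h (Equiv.injective _ h'))
    have key : ∀ j l, j ≠ l → cGen k a n (Equiv.swap (cIdx i) (cIdxSucc i) j) * dGen a n i l +
        dGen a n i j * cGen k a n l = -(cGen k a n (Equiv.swap (cIdx i) (cIdxSucc i) l) *
          dGen a n i j + dGen a n i l * cGen k a n j) := by
      intro j l hjl
      have main : ∀ l, cIdxSucc i ≠ l → cGen k a n (Equiv.swap (cIdx i) (cIdxSucc i) (cIdxSucc i))
          * dGen a n i l +
        dGen a n i (cIdxSucc i) * cGen k a n l = -(cGen k a n (Equiv.swap (cIdx i) (cIdxSucc i) l) *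
          dGen a n i (cIdxSucc i) + dGen a n i l * cGen k a n (cIdxSucc i)) := by
        intro l hl
        rcases idx_cases i l with rfl | rfl | h
        · simp [dGen, idx_ne, mul_sub, sub_mul, c_sq]
        · exact absurd rfl hl
        · rw [Equiv.swap_apply_of_ne_of_ne (idx_ne1 i l h) (idx_ne2 i l h)]
          simp [dGen, mul_sub, sub_mul, idx_ne2 i l h, c_anti a n _ _ hl,
            c_anti a n _ _ (idx_ne1 i l h).symm]
          abel
      by_cases h1 : j = cIdxSucc i
      · subst h1; exact main l hjl
      · by_cases h2 : l = cIdxSucc i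
        · subst h2
          rw [main j hjl.symm, neg_neg]
        · simp [dGen, h1, h2]
    ext x y
    fin_cases x <;> fin_cases y
    · simpa [Matrix.mul_apply] using e j l hjl
    · simpa [Matrix.mul_apply] using key j l hjl
    · simp [Matrix.mul_apply]
    · simpa [Matrix.mul_apply] using c_anti a n j l hjl

theorem exists_sd (a : k) (n : ℕ) (i : Fin (n - 1)) :
    ∃ s d : CliffordAlg k a n →ₗ[k] CliffordAlg k a n,
      s 1 = 1 ∧ d 1 = 0 ∧
      (∀ j x, s (cGen k a n j * x) = cGen k a n (Equiv.swap (cIdx i) (cIdxSucc i) j) * s x) ∧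
      (∀ j x, d (cGen k a n j * x) = cGen k a n (Equiv.swap (cIdx i) (cIdxSucc i) j) * d x
        + dGen a n i j * x) := by
  obtain ⟨F, hF⟩ := exists_twist a n i
  have h10 : ∀ x, F x 1 0 = 0 := by
    intro x
    refine c_top a n (LinearMap.ker ((Matrix.entryLinearMap k (CliffordAlg k a n)
      (1 : Fin 2) (0 : Fin 2)) ∘ₗ F.toLinearMap)) ?_ ?_ x
    · simp
    · intro j m hm
      have hm' : F m 1 0 = 0 := hm
      change F (cGen k a n j * m) 1 0 = 0
      simp [hF, Matrix.mul_apply, hm']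
  have h11 : ∀ x, F x 1 1 = x := by
    intro x
    refine c_top a n (LinearMap.eqLocus ((Matrix.entryLinearMap k (CliffordAlg k a n)
      (1 : Fin 2) (1 : Fin 2)) ∘ₗ F.toLinearMap) LinearMap.id) ?_ ?_ x
    · simp
    · intro j m hm
      have hm' : F m 1 1 = m := hm
      change F (cGen k a n j * m) 1 1 = _
      simp [hF, Matrix.mul_apply, hm']
  refine ⟨Matrix.entryLinearMap k (CliffordAlg k a n) (0 : Fin 2) (0 : Fin 2) ∘ₗ F.toLinearMap,
    Matrix.entryLinearMap k (CliffordAlg k a n) (0 : Fin 2) (1 : Fin 2) ∘ₗ F.toLinearMap,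
    ?_, ?_, ?_, ?_⟩
  · simp
  · simp
  · intro j x
    change F (cGen k a n j * x) 0 0 = _ * F x 0 0
    simp [hF, Matrix.mul_apply, h10]
  · intro j x
    change F (cGen k a n j * x) 0 1 = _ * F x 0 1 + _
    simp [hF, Matrix.mul_apply, h11]

/-! Abstract noncommutative computations. -/

section abs
variable {A : Type*} [Ring A] [Algebra k A] (r q : k)

theorem abs_quad1 (T c d : A) (h1 : T * c = d * T) (h2 : T * d = c * T + r • (d - c)) :
    (T * T - (r • T + q • 1)) * c = c * (T * T - (r • T + q • 1)) := by
  have h1' : ∀ z, T * (c * z) = d * (T * z) := fun z => by rw [← mul_assoc, h1, mul_assoc]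
  have h2' : ∀ z, T * (d * z) = c * (T * z) + r • (d * z - c * z) := fun z => by
    rw [← mul_assoc, h2, add_mul, smul_mul_assoc, sub_mul, mul_assoc]
  simp only [mul_sub, sub_mul, mul_add, add_mul, smul_mul_assoc, mul_smul_comm, mul_assoc,
    h1, h2, h1', h2', mul_one, one_mul]
  module

theorem abs_quad2 (T c d : A) (h1 : T * c = d * T) (h2 : T * d = c * T + r • (d - c)) :
    (T * T - (r • T + q • 1)) * d = d * (T * T - (r • T + q • 1)) := by
  have h1' : ∀ z, T * (c * z) = d * (T * z) := fun z => by rw [← mul_assoc, h1, mul_assoc]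
  have h2' : ∀ z, T * (d * z) = c * (T * z) + r • (d * z - c * z) := fun z => by
    rw [← mul_assoc, h2, add_mul, smul_mul_assoc, sub_mul, mul_assoc]
  simp only [mul_sub, sub_mul, mul_add, add_mul, smul_mul_assoc, mul_smul_comm, mul_assoc,
    h1, h2, h1', h2', mul_one, one_mul]
  module

theorem abs_braid (S T c d e : A) (h1 : S * c = d * S) (h2 : S * d = c * S + r • (d - c))
    (h3 : S * e = e * S) (g1 : T * c = c * T) (g2 : T * d = e * T)
    (g3 : T * e = d * T + r • (e - d))
    (hS : S * S = r • S + q • 1) (hT : T * T = r • T + q • 1) :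
    (S * T * S - T * S * T) * c = e * (S * T * S - T * S * T) ∧
    (S * T * S - T * S * T) * d = d * (S * T * S - T * S * T) ∧
    (S * T * S - T * S * T) * e = c * (S * T * S - T * S * T) := by
  have h1' : ∀ z, S * (c * z) = d * (S * z) := fun z => by rw [← mul_assoc, h1, mul_assoc]
  have h2' : ∀ z, S * (d * z) = c * (S * z) + r • (d * z - c * z) := fun z => by
    rw [← mul_assoc, h2, add_mul, smul_mul_assoc, sub_mul, mul_assoc]
  have h3' : ∀ z, S * (e * z) = e * (S * z) := fun z => by rw [← mul_assoc, h3, mul_assoc]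
  have g1' : ∀ z, T * (c * z) = c * (T * z) := fun z => by rw [← mul_assoc, g1, mul_assoc]
  have g2' : ∀ z, T * (d * z) = e * (T * z) := fun z => by rw [← mul_assoc, g2, mul_assoc]
  have g3' : ∀ z, T * (e * z) = d * (T * z) + r • (e * z - d * z) := fun z => by
    rw [← mul_assoc, g3, add_mul, smul_mul_assoc, sub_mul, mul_assoc]
  refine ⟨?_, ?_, ?_⟩ <;>
  · simp only [mul_sub, sub_mul, mul_add, add_mul, smul_mul_assoc, mul_smul_comm, mul_assoc,
      h1, h2, h1', h2', h3, h3', g1, g1', g2, g2', g3, g3', hS, hT, mul_one, one_mul, smul_add,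
      smul_sub]
    try module

theorem abs_comm (S T c d : A) (h1 : S * c = d * S) (h2 : S * d = c * S + r • (d - c))
    (g1 : T * c = c * T) (g2 : T * d = d * T) :
    (S * T - T * S) * c = d * (S * T - T * S) ∧
    (S * T - T * S) * d = c * (S * T - T * S) := by
  have h1' : ∀ z, S * (c * z) = d * (S * z) := fun z => by rw [← mul_assoc, h1, mul_assoc]
  have h2' : ∀ z, S * (d * z) = c * (S * z) + r • (d * z - c * z) := fun z => by
    rw [← mul_assoc, h2, add_mul, smul_mul_assoc, sub_mul, mul_assoc]
  have g1' : ∀ z, T * (c * z) = c * (T * z) := fun z => by rw [← mul_assoc, g1, mul_assoc]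
  have g2' : ∀ z, T * (d * z) = d * (T * z) := fun z => by rw [← mul_assoc, g2, mul_assoc]
  refine ⟨?_, ?_⟩ <;>
  · simp only [mul_sub, sub_mul, mul_add, add_mul, smul_mul_assoc, mul_smul_comm, mul_assoc,
      h1, h2, h1', h2', g1, g1', g2, g2', mul_one, one_mul, smul_add,
      smul_sub]
    try module

theorem comm_quad (T c : A) (h : T * c = c * T) :
    (T * T - (r • T + q • 1)) * c = c * (T * T - (r • T + q • 1)) := by
  have h' : ∀ z, T * (c * z) = c * (T * z) := fun z => by rw [← mul_assoc, h, mul_assoc]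
  simp only [mul_sub, sub_mul, mul_add, add_mul, smul_mul_assoc, mul_smul_comm, mul_assoc,
    h, h', mul_one, one_mul]

theorem flip_quad (T : A) (h : T * T = (q - 1) • T + q • 1) :
    ((q - 1) • (1 : A) - T) * ((q - 1) • (1 : A) - T)
      = (q - 1) • ((q - 1) • (1 : A) - T) + q • 1 := by
  simp only [mul_sub, sub_mul, smul_mul_assoc, mul_smul_comm, mul_one, one_mul, h]
  module

theorem flip_braid (S T : A) (hS : S * S = r • S + q • 1) (hT : T * T = r • T + q • 1)
    (h : S * T * S = T * S * T) :
    (r • (1 : A) - S) * (r • (1 : A) - T) * (r • (1 : A) - S)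
      = (r • (1 : A) - T) * (r • (1 : A) - S) * (r • (1 : A) - T) := by
  simp only [mul_sub, sub_mul, smul_mul_assoc, mul_smul_comm, mul_one, one_mul, hS, hT, h]
  module

end abs

end HCProof

namespace HCProof

variable {k : Type u} [CommRing k]

theorem abs_neg {A : Type*} [Ring A] (x y u v : A) (h : (x - y) * u = v * (x - y)) :
    (y - x) * u = v * (y - x) := by
  rw [← neg_sub x y, neg_mul, h, mul_neg]

section rep
variable {C H : Type*} [Ring C] [Algebra k C] [Ring H] [Algebra k H] {n : ℕ} (cg : Fin n → C)

/-- Left multiplication by `c_j` on `C ⊗ H`. -/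
noncomputable def opK (j : Fin n) :
    Module.End k (C ⊗[k] H) :=
  TensorProduct.map (LinearMap.mulLeft k (cg j)) LinearMap.id

theorem opK_tmul (j : Fin n) (x : C) (y : H) :
    opK (k := k) (H := H) cg j (x ⊗ₜ y) = (cg j * x) ⊗ₜ y := rfl

theorem op_zero
    (ctop : ∀ N : Submodule k C, 1 ∈ N → (∀ j, ∀ m ∈ N, cg j * m ∈ N) → ∀ z : C, z ∈ N)
    (B : Module.End k (C ⊗[k] H))
    (h1 : ∀ y, B (1 ⊗ₜ y) = 0) (h2 : ∀ j, ∃ j', B * opK (k := k) (H := H) cg j = opK (k := k) (H := H) cg j' * B) : B = 0 := by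
  apply TensorProduct.ext'
  intro x y
  have := ctop (LinearMap.ker (TensorProduct.curry B)) ?_ ?_ x
  · rw [LinearMap.mem_ker] at this
    simpa using LinearMap.congr_fun this y
  · rw [LinearMap.mem_ker]
    ext y
    simpa using h1 y
  · intro j m hm
    rw [LinearMap.mem_ker] at hm ⊢
    ext y
    obtain ⟨j', hj⟩ := h2 j
    have e := LinearMap.congr_fun hj (m ⊗ₜ y)
    have hm' : B (m ⊗ₜ y) = 0 := by simpa using LinearMap.congr_fun hm y
    rw [Module.End.mul_apply, Module.End.mul_apply, opK_tmul, hm', map_zero] at e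
    simpa using e

theorem exists_rep_gen (tg : Fin (n - 1) → H) (a q : k)
    (ctop : ∀ N : Submodule k C, 1 ∈ N → (∀ j, ∀ m ∈ N, cg j * m ∈ N) → ∀ z : C, z ∈ N)
    (c_sq : ∀ i, cg i * cg i = algebraMap k C a)
    (c_anti : ∀ i j, i ≠ j → cg i * cg j = -(cg j * cg i))
    (t_comm : ∀ i j : Fin (n - 1), ((i : ℕ) + 2 ≤ (j : ℕ) ∨ (j : ℕ) + 2 ≤ (i : ℕ)) →
      tg i * tg j = tg j * tg i)
    (t_braid : ∀ i j : Fin (n - 1), (j : ℕ) = (i : ℕ) + 1 →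
      tg i * tg j * tg i = tg j * tg i * tg j)
    (t_quad : ∀ i, tg i * tg i = (q - 1) • tg i + q • (1 : H))
    (sd : ∀ i : Fin (n - 1), ∃ s d : C →ₗ[k] C,
      s 1 = 1 ∧ d 1 = 0 ∧
      (∀ j x, s (cg j * x) = cg (Equiv.swap (cIdx i) (cIdxSucc i) j) * s x) ∧
      (∀ j x, d (cg j * x) = cg (Equiv.swap (cIdx i) (cIdxSucc i) j) * d x
        + (if j = cIdxSucc i then cg (cIdxSucc i) - cg (cIdx i) else 0) * x)) :
    ∃ ρ : HeckeCliffordAlg k a q n →ₐ[k] Module.End k (C ⊗[k] H),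
      (∀ j x y, ρ (hcCGen k a q n j) (x ⊗ₜ y) = (cg j * x) ⊗ₜ y) ∧
      (∀ i y, ρ (hcTGen k a q n i) (1 ⊗ₜ y) = 1 ⊗ₜ (tg i * y)) := by
  choose s d s1 d1 sc dc using sd
  let L : Fin (n - 1) → Module.End k (C ⊗[k] H) := fun i =>
    TensorProduct.map (s i) (LinearMap.mulLeft k (tg i)) +
      (q - 1) • TensorProduct.map (d i) LinearMap.id
  have L_tmul : ∀ i x y, L i (x ⊗ₜ y) =
      (s i x) ⊗ₜ (tg i * y) + (q - 1) • ((d i x) ⊗ₜ y) := fun i x y => rfl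
  have L_one : ∀ i y, L i (1 ⊗ₜ y) = 1 ⊗ₜ (tg i * y) := by
    intro i y
    simp [L_tmul, s1, d1]
  have m1 : ∀ (i : Fin (n - 1)) (j : Fin n), ((j : ℕ) ≠ (i : ℕ) ∧ (j : ℕ) ≠ (i : ℕ) + 1) →
      L i * opK (k := k) (H := H) cg j = opK (k := k) (H := H) cg j * L i := by
    intro i j h
    apply TensorProduct.ext'
    intro x y
    simp only [Module.End.mul_apply, L_tmul, opK_tmul, sc, dc, map_add, map_smul,
      Equiv.swap_apply_of_ne_of_ne (idx_ne1 i j h) (idx_ne2 i j h), if_neg (idx_ne2 i j h),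
      zero_mul, add_zero]
  have m2 : ∀ i : Fin (n - 1), L i * opK (k := k) (H := H) cg (cIdx i) = opK (k := k) (H := H) cg (cIdxSucc i) * L i := by
    intro i
    apply TensorProduct.ext'
    intro x y
    simp only [Module.End.mul_apply, L_tmul, opK_tmul, sc, dc, map_add, map_smul,
      Equiv.swap_apply_left, if_neg (idx_ne i), zero_mul, add_zero]
  have m3 : ∀ i : Fin (n - 1), L i * opK (k := k) (H := H) cg (cIdxSucc i) = opK (k := k) (H := H) cg (cIdx i) * L i
      + (q - 1) • (opK (k := k) (H := H) cg (cIdxSucc i) - opK (k := k) (H := H) cg (cIdx i)) := by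
    intro i
    apply TensorProduct.ext'
    intro x y
    simp only [Module.End.mul_apply, L_tmul, opK_tmul, sc, dc, map_add, map_smul,
      Equiv.swap_apply_right, if_pos, LinearMap.add_apply, LinearMap.smul_apply,
      LinearMap.sub_apply, TensorProduct.add_tmul, sub_mul, TensorProduct.sub_tmul]
    module
  have quad : ∀ i, L i * L i = (q - 1) • L i + q • 1 := by
    intro i
    rw [← sub_eq_zero]
    apply op_zero cg ctop
    · intro y
      simp only [LinearMap.sub_apply, LinearMap.add_apply, LinearMap.smul_apply,
        Module.End.mul_apply, L_one, Module.End.one_apply, ← mul_assoc, t_quad, add_mul,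
        smul_mul_assoc, one_mul, TensorProduct.tmul_add, TensorProduct.tmul_smul, sub_self]
    · intro j
      rcases idx_cases i j with rfl | rfl | h
      · exact ⟨_, abs_quad1 _ _ _ _ _ (m2 i) (m3 i)⟩
      · exact ⟨_, abs_quad2 _ _ _ _ _ (m2 i) (m3 i)⟩
      · exact ⟨_, comm_quad _ _ _ _ (m1 i j h)⟩
  have comm1 : ∀ i j : Fin (n - 1), (i : ℕ) + 2 ≤ (j : ℕ) ∨ (j : ℕ) + 2 ≤ (i : ℕ) →
      L i * L j = L j * L i := by
    intro i j hij
    rw [← sub_eq_zero]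
    apply op_zero cg ctop
    · intro y
      simp only [LinearMap.sub_apply, Module.End.mul_apply, L_one, ← mul_assoc,
        t_comm i j hij, sub_self]
    · intro l
      have hj1 := m1 j (cIdx i) (by simp only [cIdx]; omega)
      have hj2 := m1 j (cIdxSucc i) (by simp only [cIdxSucc]; omega)
      have hi1 := m1 i (cIdx j) (by simp only [cIdx]; omega)
      have hi2 := m1 i (cIdxSucc j) (by simp only [cIdxSucc]; omega)
      have A := abs_comm (q - 1) (L i) (L j) _ _ (m2 i) (m3 i) hj1 hj2
      have B := abs_comm (q - 1) (L j) (L i) _ _ (m2 j) (m3 j) hi1 hi2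
      have neg : ∀ u v, (L j * L i - L i * L j) * u = v * (L j * L i - L i * L j) →
          (L i * L j - L j * L i) * u = v * (L i * L j - L j * L i) := by
        intro u v h
        exact abs_neg _ _ _ _ h
      rcases idx_cases i l with rfl | rfl | h
      · exact ⟨_, A.1⟩
      · exact ⟨_, A.2⟩
      · rcases idx_cases j l with rfl | rfl | h'
        · exact ⟨_, neg _ _ B.1⟩
        · exact ⟨_, neg _ _ B.2⟩
        · refine ⟨l, ?_⟩
          rw [sub_mul, mul_sub, mul_assoc, mul_assoc, m1 i l h, m1 j l h', ← mul_assoc,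
            ← mul_assoc, m1 i l h, m1 j l h', mul_assoc, mul_assoc]
  have braid : ∀ i j : Fin (n - 1), (j : ℕ) = (i : ℕ) + 1 →
      L i * L j * L i = L j * L i * L j := by
    intro i j hij
    have e : cIdx j = cIdxSucc i := by simp [cIdx, cIdxSucc, hij]
    rw [← sub_eq_zero]
    apply op_zero cg ctop
    · intro y
      simp only [LinearMap.sub_apply, Module.End.mul_apply, L_one, ← mul_assoc,
        t_braid i j hij, sub_self]
    · intro l
      have A := abs_braid (q - 1) q (L i) (L j) _ _ _ (m2 i) (m3 i)
        (m1 i (cIdxSucc j) (by simp only [cIdxSucc]; omega))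
        (m1 j (cIdx i) (by simp only [cIdx]; omega)) (e ▸ m2 j) (e ▸ m3 j) (quad i) (quad j)
      rcases idx_cases i l with rfl | rfl | h
      · exact ⟨_, A.1⟩
      · exact ⟨_, A.2.1⟩
      · rcases idx_cases j l with rfl | rfl | h'
        · exact ⟨_, e ▸ A.2.1⟩
        · exact ⟨_, A.2.2⟩
        · refine ⟨l, ?_⟩
          have hi : Commute (L i) (opK (k := k) (H := H) cg l) := m1 i l h
          have hj : Commute (L j) (opK (k := k) (H := H) cg l) := m1 j l h'
          exact (((hi.mul_left hj).mul_left hi).sub_left ((hj.mul_left hi).mul_left hj))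
  have k1 : ∀ i, opK (k := k) (H := H) cg i * opK (k := k) (H := H) cg i =
      algebraMap k (Module.End k (C ⊗[k] H)) a := by
    intro i
    apply TensorProduct.ext'
    intro x y
    rw [Module.End.mul_apply, opK_tmul, opK_tmul, ← mul_assoc, c_sq, ← Algebra.smul_def,
      Module.algebraMap_end_apply, TensorProduct.smul_tmul']
  have k2 : ∀ i j, i ≠ j → opK (k := k) (H := H) cg i * opK (k := k) (H := H) cg j =
      -(opK (k := k) (H := H) cg j * opK (k := k) (H := H) cg i) := by
    intro i j h
    apply TensorProduct.ext'
    intro x y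
    rw [LinearMap.neg_apply, Module.End.mul_apply, Module.End.mul_apply, opK_tmul, opK_tmul,
      opK_tmul, opK_tmul, ← mul_assoc, ← mul_assoc, c_anti i j h, neg_mul,
      TensorProduct.neg_tmul]
  obtain ⟨ρ, h1, h2⟩ := exists_hcLift a q n (opK (k := k) (H := H) cg) L k1 k2 comm1 braid quad
    m1 m2 m3
  refine ⟨ρ, ?_, ?_⟩
  · intro j x y
    rw [h1, opK_tmul]
  · intro i y
    rw [h2, L_one]

end rep

theorem exists_rep (a q : k) (n : ℕ) :
    ∃ ρ : HeckeCliffordAlg k a q n →ₐ[k] Module.End k (CliffordAlg k a n ⊗[k] HeckeAlg k q n),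
      (∀ j x y, ρ (hcCGen k a q n j) (x ⊗ₜ y) = (cGen k a n j * x) ⊗ₜ y) ∧
      (∀ i y, ρ (hcTGen k a q n i) (1 ⊗ₜ y) = 1 ⊗ₜ (tGen k q n i * y)) :=
  exists_rep_gen (C := CliffordAlg k a n) (H := HeckeAlg k q n) (cGen k a n) (tGen k q n) a q
    (c_top a n) (c_sq a n) (c_anti a n) (t_comm q n) (t_braid q n) (t_quad q n) (exists_sd a n)

section main
variable (a q : k) (n : ℕ)
    (iotaC : CliffordAlg k a n →ₐ[k] HeckeCliffordAlg k a q n)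
    (iotaH : HeckeAlg k q n →ₐ[k] HeckeCliffordAlg k a q n)

/-- The first multiplication map. -/
noncomputable abbrev mul1 :=
  (TensorProduct.lift ((LinearMap.mul k (HeckeCliffordAlg k a q n)).compl₁₂
        iotaC.toLinearMap iotaH.toLinearMap))

/-- The second multiplication map. -/
noncomputable abbrev mul2 :=
  (TensorProduct.lift ((LinearMap.mul k (HeckeCliffordAlg k a q n)).compl₁₂
        iotaH.toLinearMap iotaC.toLinearMap))

theorem mul1_tmul (x y) : mul1 a q n iotaC iotaH (x ⊗ₜ y) = iotaC x * iotaH y := rfl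

theorem mul2_tmul (x y) : mul2 a q n iotaC iotaH (y ⊗ₜ x) = iotaH y * iotaC x := rfl

theorem mul1_injective
    (hC : ∀ i : Fin n, iotaC (cGen k a n i) = hcCGen k a q n i)
    (hH : ∀ i : Fin (n - 1), iotaH (tGen k q n i) = hcTGen k a q n i) : Function.Injective (mul1 a q n iotaC iotaH) := by
  obtain ⟨ρ, hc, ht⟩ := exists_rep a q n
  have key1 : ∀ y, ρ (iotaH y) (1 ⊗ₜ 1) = 1 ⊗ₜ y := by
    intro y
    refine h_top q n (LinearMap.eqLocus
      ((LinearMap.applyₗ ((1 : CliffordAlg k a n) ⊗ₜ[k] (1 : HeckeAlg k q n))) ∘ₗ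
        ρ.toLinearMap ∘ₗ iotaH.toLinearMap)
      (TensorProduct.mk k _ _ 1)) ?_ ?_ y
    · simp
    · intro j m hm
      have hm' : ρ (iotaH m) (1 ⊗ₜ 1) = 1 ⊗ₜ m := hm
      change ρ (iotaH (tGen k q n j * m)) (1 ⊗ₜ 1) = 1 ⊗ₜ _
      rw [map_mul, map_mul, Module.End.mul_apply, hm', hH, ht]
  have key2 : ∀ x y, ρ (iotaC x) (1 ⊗ₜ y) = x ⊗ₜ y := by
    intro x y
    refine c_top a n (LinearMap.eqLocus
      ((LinearMap.applyₗ ((1 : CliffordAlg k a n) ⊗ₜ[k] y)) ∘ₗ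
        ρ.toLinearMap ∘ₗ iotaC.toLinearMap)
      ((TensorProduct.mk k _ _).flip y)) ?_ ?_ x
    · simp
    · intro j m hm
      have hm' : ρ (iotaC m) (1 ⊗ₜ y) = m ⊗ₜ y := hm
      change ρ (iotaC (cGen k a n j * m)) (1 ⊗ₜ y) = _ ⊗ₜ _
      rw [map_mul, map_mul, Module.End.mul_apply, hm', hC, hc]
  have : ((LinearMap.applyₗ ((1 : CliffordAlg k a n) ⊗ₜ[k] (1 : HeckeAlg k q n))) ∘ₗ
        ρ.toLinearMap) ∘ₗ mul1 a q n iotaC iotaH = LinearMap.id := by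
    apply TensorProduct.ext'
    intro x y
    change ρ (iotaC x * iotaH y) (1 ⊗ₜ 1) = x ⊗ₜ y
    rw [map_mul, Module.End.mul_apply, key1, key2]
  intro u v huv
  have hu := LinearMap.congr_fun this u
  have hv := LinearMap.congr_fun this v
  rw [LinearMap.comp_apply, LinearMap.id_apply] at hu hv
  rw [← hu, ← hv, huv]

theorem mul1_surjective
    (hC : ∀ i : Fin n, iotaC (cGen k a n i) = hcCGen k a q n i)
    (hH : ∀ i : Fin (n - 1), iotaH (tGen k q n i) = hcTGen k a q n i) : Function.Surjective (mul1 a q n iotaC iotaH) := by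
  intro z
  refine hc_top a q n (LinearMap.range (mul1 a q n iotaC iotaH)) ?_ ?_ ?_ z
  · exact ⟨1 ⊗ₜ 1, by simp [mul1_tmul]⟩
  · rintro j _ ⟨w, rfl⟩
    induction w with
    | zero => simp
    | add u v hu hv =>
      rw [map_add, mul_add]
      exact Submodule.add_mem _ hu hv
    | tmul x y =>
      refine ⟨(cGen k a n j * x) ⊗ₜ y, ?_⟩
      rw [mul1_tmul, mul1_tmul, map_mul, hC, mul_assoc]
  · intro i
    obtain ⟨s, d, s1, d1, sc, dc⟩ := exists_sd a n i
    have key : ∀ x, hcTGen k a q n i * iotaC x =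
        iotaC (s x) * hcTGen k a q n i + (q - 1) • iotaC (d x) := by
      intro x
      refine c_top a n (LinearMap.eqLocus
        (LinearMap.mulLeft k (hcTGen k a q n i) ∘ₗ iotaC.toLinearMap)
        (LinearMap.mulRight k (hcTGen k a q n i) ∘ₗ iotaC.toLinearMap ∘ₗ s +
          (q - 1) • iotaC.toLinearMap ∘ₗ d)) ?_ ?_ x
      · simp [s1, d1]
      · intro j m hm
        have hm' : hcTGen k a q n i * iotaC m =
          iotaC (s m) * hcTGen k a q n i + (q - 1) • iotaC (d m) := hm
        change hcTGen k a q n i * iotaC (cGen k a n j * m) =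
          iotaC (s (cGen k a n j * m)) * hcTGen k a q n i + (q - 1) • iotaC (d (cGen k a n j * m))
        rw [sc, dc, map_mul, map_add, map_mul, map_mul, map_mul, hC, hC, ← mul_assoc]
        rcases idx_cases i j with rfl | rfl | h
        · rw [hc_tc_shift, mul_assoc, hm', Equiv.swap_apply_left, dGen, if_neg (idx_ne i)]
          simp [mul_add, mul_assoc]
        · rw [hc_tc_mixed, add_mul, mul_assoc, hm', Equiv.swap_apply_right, dGen, if_pos rfl,
            map_sub, hC, hC]
          simp only [mul_add, mul_assoc, smul_add, mul_smul_comm, smul_mul_assoc]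
          abel
        · rw [hc_tc_comm _ _ _ _ _ h, mul_assoc, hm',
            Equiv.swap_apply_of_ne_of_ne (idx_ne1 i j h) (idx_ne2 i j h), dGen,
            if_neg (idx_ne2 i j h)]
          simp [mul_add, mul_assoc]
    rintro _ ⟨w, rfl⟩
    induction w with
    | zero => simp
    | add u v hu hv =>
      rw [map_add, mul_add]
      exact Submodule.add_mem _ hu hv
    | tmul x y =>
      refine ⟨s x ⊗ₜ (tGen k q n i * y) + (q - 1) • (d x ⊗ₜ y), ?_⟩
      rw [map_add, map_smul, mul1_tmul, mul1_tmul, mul1_tmul, ← mul_assoc, key, map_mul, hH,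
        add_mul, smul_mul_assoc, mul_assoc]

/-! Anti-automorphisms. -/

open MulOpposite in
theorem exists_sigmaC : ∃ f : CliffordAlg k a n →ₐ[k] (CliffordAlg k a n)ᵐᵒᵖ,
    ∀ i, f (cGen k a n i) = op (cGen k a n i) := by
  apply exists_cLift
  · intro i
    rw [← op_mul, c_sq]; rfl
  · intro i j h
    rw [← op_mul, ← op_mul, ← op_neg, c_anti a n j i h.symm]

open MulOpposite in
theorem exists_sigmaH : ∃ f : HeckeAlg k q n →ₐ[k] (HeckeAlg k q n)ᵐᵒᵖ,
    ∀ i, f (tGen k q n i) = op ((q - 1) • 1 - tGen k q n i) := by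
  apply exists_tLift
  · intro i j h
    rw [← op_mul, ← op_mul]
    congr 1
    simp only [mul_sub, sub_mul, smul_mul_assoc, mul_smul_comm, mul_one, one_mul,
      t_comm q n i j h]
    module
  · intro i j h
    simp only [← op_mul, ← mul_assoc]
    rw [flip_braid (q - 1) q _ _ (t_quad q n i) (t_quad q n j) (t_braid q n i j h)]
  · intro i
    rw [← op_mul, flip_quad q _ (t_quad q n i)]
    rfl

open MulOpposite in
theorem exists_sigma : ∃ f : HeckeCliffordAlg k a q n →ₐ[k] (HeckeCliffordAlg k a q n)ᵐᵒᵖ,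
    (∀ i, f (hcCGen k a q n i) = op (hcCGen k a q n i)) ∧
    ∀ i, f (hcTGen k a q n i) = op ((q - 1) • 1 - hcTGen k a q n i) := by
  apply exists_hcLift
  · intro i
    rw [← op_mul, hc_sq]; rfl
  · intro i j h
    rw [← op_mul, ← op_mul, ← op_neg, hc_anti a q n j i h.symm]
  · intro i j h
    rw [← op_mul, ← op_mul]
    congr 1
    simp only [mul_sub, sub_mul, smul_mul_assoc, mul_smul_comm, mul_one, one_mul,
      hc_tcomm a q n i j h]
    module
  · intro i j h
    simp only [← op_mul, ← mul_assoc]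
    rw [flip_braid (q - 1) q _ _ (hc_tquad a q n i) (hc_tquad a q n j) (hc_tbraid a q n i j h)]
  · intro i
    rw [← op_mul, flip_quad q _ (hc_tquad a q n i)]
    rfl
  · intro i j h
    rw [← op_mul, ← op_mul]
    congr 1
    simp only [mul_sub, sub_mul, smul_mul_assoc, mul_smul_comm, mul_one, one_mul,
      hc_tc_comm a q n i j h]
  · intro i
    rw [← op_mul, ← op_mul]
    congr 1
    simp only [mul_sub, sub_mul, smul_mul_assoc, mul_smul_comm, mul_one, one_mul,
      hc_tc_mixed a q n i]
    module
  · intro i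
    rw [← op_mul, ← op_mul, ← op_sub, ← op_smul, ← op_add]
    congr 1
    simp only [mul_sub, sub_mul, smul_mul_assoc, mul_smul_comm, mul_one, one_mul,
      hc_tc_shift a q n i]
    module

open MulOpposite in
/-- An anti-endomorphism that squares to the identity on generators is bijective. -/
theorem anti_bij {X A : Type*} [Ring A] [Algebra k A] (p : FreeAlgebra k X →ₐ[k] A)
    (hp : Function.Surjective p) (f : A →ₐ[k] Aᵐᵒᵖ)
    (h : ∀ x, unop (f (unop (f (p (FreeAlgebra.ι k x))))) = p (FreeAlgebra.ι k x)) :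
    Function.Bijective f := by
  have inv : ∀ z, unop (f (unop (f z))) = z := by
    intro z
    refine gen_top p hp (LinearMap.eqLocus ((opLinearEquiv k).symm.toLinearMap ∘ₗ f.toLinearMap ∘ₗ
      (opLinearEquiv k).symm.toLinearMap ∘ₗ f.toLinearMap) LinearMap.id) ?_ ?_ z
    · simp
    · intro x m hm
      have hm' : unop (f (unop (f m))) = m := hm
      change unop (f (unop (f (p (FreeAlgebra.ι k x) * m)))) = _
      rw [map_mul, unop_mul, map_mul, unop_mul, hm', h]
      rfl
  refine ⟨fun x y hxy => ?_, fun y => ⟨unop (f (unop y)), ?_⟩⟩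
  · rw [← inv x, hxy, inv]
  · rw [← op_unop y]
    exact congrArg op (inv (unop y))

open MulOpposite in
theorem mul2_bijective
    (hC : ∀ i : Fin n, iotaC (cGen k a n i) = hcCGen k a q n i)
    (hH : ∀ i : Fin (n - 1), iotaH (tGen k q n i) = hcTGen k a q n i) : Function.Bijective (mul2 a q n iotaC iotaH) := by
  obtain ⟨fC', hfC⟩ := exists_sigmaC a n
  obtain ⟨fH, hfH⟩ := exists_sigmaH q n
  obtain ⟨f, hf1, hf2⟩ := exists_sigma a q n
  have bC : Function.Bijective fC' := anti_bij _ (RingQuot.mkAlgHom_surjective k _) fC' (by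
    intro x
    change unop (fC' (unop (fC' (cGen k a n x)))) = cGen k a n x
    simp [hfC])
  have bH : Function.Bijective fH := anti_bij _ (RingQuot.mkAlgHom_surjective k _) fH (by
    intro x
    change unop (fH (unop (fH (tGen k q n x)))) = tGen k q n x
    rw [hfH, unop_op, map_sub, map_smul, map_one, hfH, unop_sub, unop_smul, unop_one, unop_op,
      sub_sub_cancel])
  have bf : Function.Bijective f := anti_bij _ (RingQuot.mkAlgHom_surjective k _) f (by
    rintro (x | x)
    · change unop (f (unop (f (hcCGen k a q n x)))) = hcCGen k a q n x
      rw [hf1, unop_op, hf1, unop_op]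
    · change unop (f (unop (f (hcTGen k a q n x)))) = hcTGen k a q n x
      rw [hf2, unop_op, map_sub, map_smul, map_one, hf2, unop_sub, unop_smul, unop_one, unop_op,
        sub_sub_cancel])
  have eC : ∀ x, iotaC (unop (fC' x)) = unop (f (iotaC x)) := by
    intro x
    refine c_top a n (LinearMap.eqLocus
      (iotaC.toLinearMap ∘ₗ (opLinearEquiv k).symm.toLinearMap ∘ₗ fC'.toLinearMap)
      ((opLinearEquiv k).symm.toLinearMap ∘ₗ f.toLinearMap ∘ₗ iotaC.toLinearMap)) ?_ ?_ x
    · simp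
    · intro j m hm
      have hm' : iotaC (unop (fC' m)) = unop (f (iotaC m)) := hm
      change iotaC (unop (fC' (cGen k a n j * m))) = unop (f (iotaC (cGen k a n j * m)))
      simp only [map_mul, unop_mul, hm', hC, hf1, hfC, unop_op]
  have eH : ∀ x, iotaH (unop (fH x)) = unop (f (iotaH x)) := by
    intro x
    refine h_top q n (LinearMap.eqLocus
      (iotaH.toLinearMap ∘ₗ (opLinearEquiv k).symm.toLinearMap ∘ₗ fH.toLinearMap)
      ((opLinearEquiv k).symm.toLinearMap ∘ₗ f.toLinearMap ∘ₗ iotaH.toLinearMap)) ?_ ?_ x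
    · simp
    · intro j m hm
      have hm' : iotaH (unop (fH m)) = unop (f (iotaH m)) := hm
      change iotaH (unop (fH (tGen k q n j * m))) = unop (f (iotaH (tGen k q n j * m)))
      simp only [map_mul, unop_mul, hm', hH, hf2, hfH, unop_op, map_sub, map_smul, map_one]
  let gC : CliffordAlg k a n ≃ₗ[k] CliffordAlg k a n :=
    (LinearEquiv.ofBijective fC'.toLinearMap bC).trans (opLinearEquiv k).symm
  let gH : HeckeAlg k q n ≃ₗ[k] HeckeAlg k q n :=
    (LinearEquiv.ofBijective fH.toLinearMap bH).trans (opLinearEquiv k).symm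
  let g : HeckeCliffordAlg k a q n ≃ₗ[k] HeckeCliffordAlg k a q n :=
    (LinearEquiv.ofBijective f.toLinearMap bf).trans (opLinearEquiv k).symm
  let E := (TensorProduct.congr gC gH).trans (TensorProduct.comm k _ _)
  have comp : mul2 a q n iotaC iotaH ∘ₗ E.toLinearMap = g.toLinearMap ∘ₗ mul1 a q n iotaC iotaH := by
    apply TensorProduct.ext'
    intro x y
    change iotaH (unop (fH y)) * iotaC (unop (fC' x)) = unop (f (iotaC x * iotaH y))
    rw [eC, eH, map_mul, unop_mul]
  have b1 : Function.Bijective (mul1 a q n iotaC iotaH) :=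
    ⟨mul1_injective a q n iotaC iotaH hC hH, mul1_surjective a q n iotaC iotaH hC hH⟩
  have b2 : Function.Bijective (mul2 a q n iotaC iotaH ∘ E) := by
    have : (mul2 a q n iotaC iotaH ∘ E) = g ∘ mul1 a q n iotaC iotaH :=
      funext (LinearMap.congr_fun comp)
    rw [this]
    exact g.bijective.comp b1
  exact (Function.Bijective.of_comp_iff _ E.bijective).1 b2

end main

end HCProof

/-- Let `k` be a commutative ring, `a, q ∈ k`, and `n ∈ ℕ`.  Let
`ι_C : C_n(a) → H^c_n(a;q)` and `ι_H : H_n(q) → H^c_n(a;q)` be the canonical algebra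
homomorphisms (sending generators to the generators of the same name).  Then the
`k`-linear multiplication maps `C_n(a) ⊗[k] H_n(q) → H^c_n(a;q)`, `x ⊗ y ↦ ι_C x · ι_H y`,
and `H_n(q) ⊗[k] C_n(a) → H^c_n(a;q)`, `y ⊗ x ↦ ι_H y · ι_C x`, are both isomorphisms of
`k`-modules. -/
theorem heckeClifford_basis_theorem (a q : k) (n : ℕ)
    (iotaC : CliffordAlg k a n →ₐ[k] HeckeCliffordAlg k a q n)
    (hC : ∀ i : Fin n, iotaC (cGen k a n i) = hcCGen k a q n i)
    (iotaH : HeckeAlg k q n →ₐ[k] HeckeCliffordAlg k a q n)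
    (hH : ∀ i : Fin (n - 1), iotaH (tGen k q n i) = hcTGen k a q n i) :
    Function.Bijective (TensorProduct.lift
      ((LinearMap.mul k (HeckeCliffordAlg k a q n)).compl₁₂
        iotaC.toLinearMap iotaH.toLinearMap)) ∧
    Function.Bijective (TensorProduct.lift
      ((LinearMap.mul k (HeckeCliffordAlg k a q n)).compl₁₂
        iotaH.toLinearMap iotaC.toLinearMap)) := by
  exact ⟨⟨HCProof.mul1_injective a q n iotaC iotaH hC hH,
    HCProof.mul1_surjective a q n iotaC iotaH hC hH⟩,
    HCProof.mul2_bijective a q n iotaC iotaH hC hH⟩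
end
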